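/- arXiv:1409.0299 — 3 statements merged into one kernel-verified Lean document; each statement's English description precedes it below -/
import Mathlib

section
/- Let A ⊆ B be an extension of commutative rings, and let M ⊆ N be an extension of positive (trivial unit group) commutative cancellative torsion-free monoids with N affine (finitely generated). If the monoid algebra A[M] is subintegrally closed in B[N], then the canonical group homomorphism θ : 𝓘(A,B) → 𝓘(A[M],B[N]), sending an invertible A-submodule I of B to the A[M]-submodule of B[N] generated by I, is an isomorphism. -/
open scoped Classical

noncomputable section

/-- `A` is subintegrally closed in its ambient ring `B`:
every `b : B` with `b² ∈ A` and `b³ ∈ A` lies in `A`. -/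
def Subring.IsSubintegrallyClosedIn {B : Type*} [CommRing B] (A : Subring B) : Prop :=
  ∀ b : B, b ^ 2 ∈ A → b ^ 3 ∈ A → b ∈ A

/-- `M` is subintegrally closed in its ambient monoid `N`:
every `x : N` with `x² ∈ M` and `x³ ∈ M` lies in `M`. -/
def Submonoid.IsSubintegrallyClosedIn {N : Type*} [CommMonoid N] (M : Submonoid N) : Prop :=
  ∀ x : N, x ^ 2 ∈ M → x ^ 3 ∈ M → x ∈ M

/-- A commutative monoid is torsion-free. -/
def MulTorsionFree (N : Type*) [CommMonoid N] : Prop :=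
  ∀ (x y : N) (n : ℕ), n ≠ 0 → x ^ n = y ^ n → x = y

/-- A commutative monoid is positive if its only unit is the identity. -/
def IsPositiveMonoid (N : Type*) [CommMonoid N] : Prop :=
  ∀ x : N, IsUnit x → x = 1

/-- The subring `A[M]` of the monoid algebra `B[N]`, for a subring `A ⊆ B` and a submonoid
`M ⊆ N`: the subring generated by the elements `a·m` (`a ∈ A`, `m ∈ M`); equivalently, the set
of elements of `B[N]` supported on `M` with all coefficients in `A`. -/
def monoidAlgebraSubring {B : Type*} [CommRing B] {N : Type*} [CommMonoid N]
    (A : Subring B) (M : Submonoid N) : Subring (MonoidAlgebra B N) :=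
  Subring.closure {x | ∃ a ∈ A, ∃ m ∈ M, x = MonoidAlgebra.single m a}

/-- The canonical group homomorphism `θ : 𝓘(A,B) → 𝓘(A[M],B[N])`, sending an invertible
`A`-submodule `I` of `B` to the `A[M]`-submodule of `B[N]` generated by (the image of) `I`,
is an isomorphism of groups.  This is phrased as: there is a group isomorphism
`𝓘(A,B) ≃* 𝓘(A[M],B[N])` whose underlying map is the canonical one. -/
def ThetaIsIso {B : Type*} [CommRing B] {N : Type*} [CancelCommMonoid N]
    (A : Subring B) (M : Submonoid N) : Prop :=
  ∃ e : (Submodule A B)ˣ ≃* (Submodule (monoidAlgebraSubring A M) (MonoidAlgebra B N))ˣ,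
    ∀ I : (Submodule A B)ˣ,
      (e I : Submodule (monoidAlgebraSubring A M) (MonoidAlgebra B N)) =
        Submodule.span (monoidAlgebraSubring A M)
          (⇑(MonoidAlgebra.singleOneRingHom : B →+* MonoidAlgebra B N) ''
            ((I : Submodule A B) : Set B))

section PolynomialExtension
open Polynomial

/-- A rank one idempotent matrix over `K[X]` which factors over `L[X]` and
whose factors have constant terms in `K` has all its factors in `K[X]`, for `K` a field and `L` a
reduced `K`-algebra. -/
theorem exists_map_eq_of_isReduced {K L ι : Type*} [Field K] [CommRing L] [IsReduced L]
    [Algebra K L] [Fintype ι] (f g : ι → L[X]) (m : ι → ι → K[X]) (a b : ι → K)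
    (hm : ∀ i j, (m i j).map (algebraMap K L) = f i * g j) (hfg : ∑ i, f i * g i = 1)
    (ha : ∀ i, (f i).coeff 0 = algebraMap K L (a i))
    (hb : ∀ i, (g i).coeff 0 = algebraMap K L (b i)) (j : ι) :
    ∃ q : K[X], q.map (algebraMap K L) = f j := by
  rcases subsingleton_or_nontrivial L with hL | hL
  · exact ⟨0, Subsingleton.elim _ _⟩
  have hinj : Function.Injective (mapRingHom (algebraMap K L)) :=
    map_injective _ (algebraMap K L).injective
  set φ : K[X] →+* L[X] := mapRingHom (algebraMap K L) with hφ
  replace hm : ∀ i j, φ (m i j) = f i * g j := hm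
  have hab : ∑ i, a i * b i = 1 := by
    have h := congrArg (fun p : L[X] => p.coeff 0) hfg
    simp only [finsetSum_coeff, mul_coeff_zero, ha, hb, coeff_one_zero, ← map_mul,
      ← map_sum] at h
    exact (algebraMap K L).injective (by rw [h, map_one])
  set fs : L[X] := ∑ i, φ (C (b i)) * f i with hfs
  set gs : L[X] := ∑ i, φ (C (a i)) * g i with hgs
  let h : ι → K[X] := fun k => ∑ i, C (a i) * m k i
  have hh : ∀ k, φ (h k) = f k * gs := fun k => by
    simp only [h, hgs, map_sum, map_mul, hm, Finset.mul_sum]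
    exact Finset.sum_congr rfl fun i _ => by ring
  have hfs0 : fs.coeff 0 = 1 := by
    simp [hfs, hφ, finsetSum_coeff, ha, ← map_mul, ← map_sum, mul_comm, hab]
  let q : K[X] := ∑ i, C (b i) * h i
  have hq : φ q = fs * gs := by
    simp only [q, hfs, map_sum, map_mul, hh, Finset.sum_mul, mul_assoc]
  have hq0 : q ≠ 0 := by
    intro hq0
    have h1 : (φ q).coeff 0 = 1 := by
      rw [hq, mul_coeff_zero, hfs0]
      simp [hgs, hφ, finsetSum_coeff, hb, ← map_mul, ← map_sum, hab]
    rw [hq0] at h1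
    simp at h1
  obtain ⟨h₀, hh₀⟩ := (IsPrincipalIdealRing.principal (Ideal.span (Set.range h))).principal
  have hd : ∀ k, ∃ d, h k = d * h₀ := fun k => by
    have : h k ∈ Ideal.span (Set.range h) := Ideal.subset_span ⟨k, rfl⟩
    rw [hh₀] at this
    obtain ⟨d, hd⟩ := Submodule.mem_span_singleton.1 this
    exact ⟨d, by rw [← hd, smul_eq_mul]⟩
  choose d hd using hd
  have hc : h₀ ∈ Ideal.span (Set.range h) := hh₀ ▸ Submodule.mem_span_singleton_self h₀
  obtain ⟨c, hc⟩ := (Submodule.mem_span_range_iff_exists_fun _).1 hc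
  simp only [smul_eq_mul] at hc
  set f₀ : L[X] := ∑ i, φ (c i) * f i with hf₀
  have hf₀g : f₀ * gs = φ h₀ := by
    simp only [← hc, hf₀, map_sum, map_mul, hh, Finset.sum_mul, mul_assoc]
  have key : ∀ k, f k = φ (d k) * f₀ := fun k => by
    have hu : (f k - φ (d k) * f₀) * gs = 0 := by
      rw [sub_mul, ← hh, mul_assoc, hf₀g, hd, map_mul, sub_self]
    have hz : ∀ l, (f k - φ (d k) * f₀) * g l = 0 := fun l => by
      have he : φ (m k l - d k * ∑ i, c i * m i l) = (f k - φ (d k) * f₀) * g l := by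
        simp only [map_sub, map_mul, map_sum, hm, hf₀, sub_mul, Finset.sum_mul, mul_assoc]
      have h0 : φ ((m k l - d k * ∑ i, c i * m i l) * q) = 0 := by
        rw [map_mul, he, hq]
        linear_combination (g l * fs) * hu
      rw [← he, (mul_eq_zero.1 ((map_eq_zero_iff φ hinj).1 h0)).resolve_right hq0, map_zero]
    rw [← sub_eq_zero, ← mul_one (f k - φ (d k) * f₀), ← hfg, Finset.mul_sum]
    exact Finset.sum_eq_zero fun l _ => by linear_combination f l * hz l
  have hunit : IsUnit f₀ := .of_mul_eq_one (∑ i, φ (d i) * g i) <| by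
    rw [← hfg, Finset.mul_sum]
    exact Finset.sum_congr rfl fun i _ => by rw [key i]; ring
  obtain ⟨u, hu⟩ : ∃ u, f₀ = C u := by
    refine ⟨f₀.coeff 0, ?_⟩
    ext n
    rcases eq_or_ne n 0 with rfl | hn
    · simp
    · rw [coeff_C_of_ne_zero hn]
      exact ((isUnit_iff_coeff_isUnit_isNilpotent.1 hunit).2 n hn).eq_zero
  have hδ : algebraMap K L ((∑ i, C (b i) * d i).coeff 0) * u = 1 := by
    rw [← hfs0]
    have : fs = φ (∑ i, C (b i) * d i) * f₀ := by
      simp only [hfs, map_sum, map_mul, Finset.sum_mul, mul_assoc, ← key]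
    rw [this, mul_coeff_zero, hu, coeff_C_zero, hφ, coe_mapRingHom, coeff_map]
  set δ := (∑ i, C (b i) * d i).coeff 0
  have hδ0 : δ ≠ 0 := fun h => by simp [h] at hδ
  have hu' : u = algebraMap K L δ⁻¹ := by
    calc u = algebraMap K L (δ⁻¹ * δ) * u := by rw [inv_mul_cancel₀ hδ0, map_one, one_mul]
      _ = _ := by rw [map_mul, mul_assoc, hδ, mul_one]
  refine ⟨d j * C δ⁻¹, ?_⟩
  rw [key j, hu, hu']
  simp [hφ]

/-- A finite ring extension that is closed under `c², c³ ∈ R → c ∈ R` is trivial as soon as its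
generators become trivial in every reduced algebra over a field. -/
theorem algebraMap_surjective_of_forall_field {R : Type u} {T : Type v} [CommRing R] [CommRing T]
    [Algebra R T] [Module.Finite R T]
    (hcl : ∀ c : T, c ^ 2 ∈ (algebraMap R T).range → c ^ 3 ∈ (algebraMap R T).range →
      c ∈ (algebraMap R T).range)
    (X : Set T) (hX : Algebra.adjoin R X = ⊤)
    (H : ∀ (K : Type u) (L : Type v) [Field K] [CommRing L] [IsReduced L] [Algebra K L]
      (r : R →+* K) (t : T →+* L), t.comp (algebraMap R T) = (algebraMap K L).comp r →
      ∀ x ∈ X, ∃ y, algebraMap K L y = t x) :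
    Function.Surjective (algebraMap R T) := by
  let c : Ideal T :=
    { carrier := {x | ∀ y, x * y ∈ (algebraMap R T).range}
      add_mem' := fun hx hx' y => by rw [add_mul]; exact add_mem (hx y) (hx' y)
      zero_mem' := fun y => by rw [zero_mul]; exact zero_mem _
      smul_mem' := fun s x hx y => by
        rw [smul_eq_mul, mul_comm s, mul_assoc]; exact hx _ }
  have hc_mem : ∀ x, x ∈ c ↔ ∀ y, x * y ∈ (algebraMap R T).range := fun x => Iff.rfl
  have hrad : c.IsRadical := by
    refine (c.isRadical_iff_pow_one_lt 2 one_lt_two).2 fun x hx y => hcl _ ?_ ?_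
    · rw [mul_pow]
      exact hx _
    · rw [show (x * y) ^ 3 = x ^ 2 * (x * y ^ 3) by ring]
      exact hx _
  by_contra hsurj
  let I := c.comap (algebraMap R T)
  have hI : I ≠ ⊤ := by
    intro h
    apply hsurj
    intro x
    have h1 : (1 : T) ∈ c := by
      have : (1 : R) ∈ I := h ▸ Submodule.mem_top
      simpa [I] using this
    simpa using h1 x
  obtain ⟨p, hp⟩ := I.nonempty_minimalPrimes hI
  have hpp : p.IsPrime := hp.isPrime
  have hIp : I ≤ p := hp.le
  have hnil : ∀ x ∈ p, ∃ s ∉ p, s * x ∈ I := by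
    intro x hx
    have h1 := (IsLocalization.AtPrime.radical_map_of_mem_minimalPrimes
      (A := Localization.AtPrime p) p I hp).ge (Ideal.mem_map_of_mem _ hx)
    obtain ⟨n, hn⟩ := h1
    rw [← map_pow, IsLocalization.algebraMap_mem_map_algebraMap_iff p.primeCompl] at hn
    obtain ⟨s, hs, hsx⟩ := hn
    refine ⟨s, hs, ?_⟩
    have hIr : I.IsRadical := hrad.comap _
    refine hIr ⟨n + 1, ?_⟩
    have : (s * x) ^ (n + 1) = s ^ n * x * (s * x ^ n) := by ring
    rw [this]
    exact I.mul_mem_left _ hsx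
  let S : Submonoid (T ⧸ c) := Algebra.algebraMapSubmonoid (T ⧸ c) p.primeCompl
  let L := Localization S
  have : IsReduced (T ⧸ c) := (Ideal.isRadical_iff_quotient_reduced c).1 hrad
  have : IsReduced L := isReduced_localizationPreserves S L inferInstance
  let t : T →+* L := (algebraMap (T ⧸ c) L).comp (Ideal.Quotient.mk c)
  have ht : ∀ x, t x = 0 ↔ ∃ s ∉ p, algebraMap R T s * x ∈ c := by
    intro x
    simp only [t, RingHom.comp_apply, IsLocalization.map_eq_zero_iff S]
    constructor
    · rintro ⟨⟨_, s, hs, rfl⟩, h⟩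
      exact ⟨s, hs, Ideal.Quotient.eq_zero_iff_mem.1 (by rw [map_mul]; exact h)⟩
    · rintro ⟨s, hs, h⟩
      refine ⟨⟨_, s, hs, rfl⟩, ?_⟩
      rw [← Ideal.Quotient.eq_zero_iff_mem, map_mul] at h
      exact h
  let e : p.ResidueField →+* L := Ideal.ResidueField.lift p (t.comp (algebraMap R T))
    (fun x hx => by
      obtain ⟨s, hs, hsx⟩ := hnil x hx
      refine (ht _).2 ⟨s, hs, ?_⟩
      rw [← map_mul]
      exact hsx)
    (fun x hx => IsLocalization.map_units L (⟨_, x, hx, rfl⟩ : S))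
  have he : ∀ x, e (algebraMap R _ x) = t (algebraMap R T x) := fun x =>
    Ideal.ResidueField.lift_algebraMap ..
  let := e.toAlgebra
  have hloc : ∀ x ∈ X, ∃ s ∉ p, algebraMap R T s * x ∈ (algebraMap R T).range := by
    intro x hx
    obtain ⟨y, hy⟩ := H p.ResidueField L (algebraMap R p.ResidueField) t
      (RingHom.ext fun x => (he x).symm) x hx
    obtain ⟨a, s, hs, hy'⟩ : ∃ a s : R, s ∉ p ∧ y * algebraMap R _ s = algebraMap R _ a := by
      obtain ⟨⟨a, s⟩, h⟩ := IsLocalization.surj (nonZeroDivisors (R ⧸ p)) y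
      obtain ⟨a, rfl⟩ := Ideal.Quotient.mk_surjective a
      obtain ⟨s, hs⟩ := s
      obtain ⟨s, rfl⟩ := Ideal.Quotient.mk_surjective s
      refine ⟨a, s, fun hsp => nonZeroDivisors.ne_zero hs (Ideal.Quotient.eq_zero_iff_mem.2 hsp), ?_⟩
      simpa only [IsScalarTower.algebraMap_apply R (R ⧸ p) p.ResidueField] using! h
    have h1 : t (algebraMap R T s * x - algebraMap R T a) = 0 := by
      have h2 := congrArg e hy'
      rw [map_mul, he, he] at h2
      rw [map_sub, map_mul, ← hy, sub_eq_zero, mul_comm]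
      exact h2
    obtain ⟨s', hs', h2⟩ := (ht _).1 h1
    refine ⟨s' * s, fun h => (hpp.mem_or_mem h).elim hs' hs, ?_⟩
    have := ((hc_mem _).1 h2) 1
    rw [mul_one, mul_sub, ← map_mul, ← mul_assoc, ← map_mul] at this
    simpa using add_mem this (⟨s' * a, rfl⟩ : algebraMap R T (s' * a) ∈ (algebraMap R T).range)
  have hall : ∀ x : T, ∃ s ∉ p, algebraMap R T s * x ∈ (algebraMap R T).range := by
    intro x
    have hx : x ∈ Algebra.adjoin R X := hX ▸ Algebra.mem_top
    induction hx using Algebra.adjoin_induction with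
    | mem x hx => exact hloc x hx
    | algebraMap r => exact ⟨1, p.one_notMem, 1 * r, by simp⟩
    | add x y _ _ hx hy =>
      obtain ⟨s, hs, u, hu⟩ := hx
      obtain ⟨s', hs', u', hu'⟩ := hy
      refine ⟨s * s', fun h => (hpp.mem_or_mem h).elim hs hs', s' * u + s * u', ?_⟩
      simp only [map_add, map_mul, hu, hu']
      ring
    | mul x y _ _ hx hy =>
      obtain ⟨s, hs, u, hu⟩ := hx
      obtain ⟨s', hs', u', hu'⟩ := hy
      refine ⟨s * s', fun h => (hpp.mem_or_mem h).elim hs hs', u * u', ?_⟩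
      simp only [map_mul, hu, hu']
      ring
  choose s hs hsx using hall
  obtain ⟨F, hF⟩ := Module.Finite.fg_top (R := R) (M := T)
  have hprod : ∏ x ∈ F, s x ∈ I := by
    intro y
    have hy : y ∈ Submodule.span R (F : Set T) := hF ▸ Submodule.mem_top
    induction hy using Submodule.span_induction with
    | mem x hx =>
      rw [← Finset.prod_erase_mul _ _ hx, map_mul, mul_assoc]
      exact mul_mem ⟨_, rfl⟩ (hsx x)
    | zero => rw [mul_zero]; exact zero_mem _
    | add x y _ _ hx hy => rw [mul_add]; exact add_mem hx hy
    | smul r x _ hx =>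
      rw [Algebra.smul_def, mul_left_comm]
      exact mul_mem ⟨_, rfl⟩ hx
  obtain ⟨x, -, hx⟩ := (Ideal.IsPrime.prod_mem_iff (hp := hpp)).1 (hIp hprod)
  exact hs x hx


theorem monic_reflect {R : Type*} [CommRing R] {p : R[X]} {N : ℕ} (hN : p.natDegree ≤ N)
    (hp : p.coeff 0 = 1) : (p.reflect N).Monic :=
  monic_of_natDegree_le_of_coeff_eq_one N (natDegree_reflect_le.trans (by simp [hN]))
    (by rw [coeff_reflect, revAt_le le_rfl, Nat.sub_self, hp])

/-- A factor with constant term `1` of a polynomial over `R` with constant term `1` has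
coefficients integral over `R`. -/
theorem isIntegral_coeff_of_mul_eq_map {R S : Type*} [CommRing R] [CommRing S] [Algebra R S]
    (hinj : Function.Injective (algebraMap R S)) {f g : S[X]} {p : R[X]}
    (hp : p.map (algebraMap R S) = f * g) (hp0 : p.coeff 0 = 1)
    (hf : f.coeff 0 = 1) (n : ℕ) : IsIntegral R (f.coeff n) := by
  have hpN : p.natDegree ≤ f.natDegree + g.natDegree := by
    rw [← natDegree_map_eq_of_injective hinj p, hp]
    exact natDegree_mul_le
  have h := isIntegral_coeff_of_dvd (p.reflect (f.natDegree + g.natDegree))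
    (f.reflect f.natDegree) (monic_reflect hpN hp0) (monic_reflect le_rfl hf)
    ⟨g.reflect g.natDegree, by rw [← reflect_map, hp, reflect_mul _ _ le_rfl le_rfl]⟩
    (revAt f.natDegree n)
  rwa [coeff_reflect, revAt_invol] at h

/-- If `f i * g j` has coefficients in `R` for all `i`, `j`, `∑ f i * g i = 1`, and all constant
terms lie in `R`, then the coefficients of the `f i` are integral over `R`. -/
theorem isIntegral_coeff_of_sum_mul_eq_one {S ι : Type*} [CommRing S] [Fintype ι] (R : Subring S)
    (f g : ι → S[X]) (hm : ∀ i j, f i * g j ∈ (mapRingHom R.subtype).range)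
    (hfg : ∑ i, f i * g i = 1) (hf : ∀ i, (f i).coeff 0 ∈ R) (hg : ∀ i, (g i).coeff 0 ∈ R)
    (i : ι) (n : ℕ) : IsIntegral R ((f i).coeff n) := by
  have hC : ∀ a ∈ R, C a ∈ (mapRingHom R.subtype).range := fun a ha => ⟨C ⟨a, ha⟩, by simp⟩
  have h0 : ∑ i, (f i).coeff 0 * (g i).coeff 0 = 1 := by
    simpa [finsetSum_coeff, mul_coeff_zero] using congrArg (fun p : S[X] => p.coeff 0) hfg
  set fs : S[X] := ∑ i, f i * C ((g i).coeff 0) with hfs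
  set gs : S[X] := ∑ i, C ((f i).coeff 0) * g i with hgs
  have hfs0 : fs.coeff 0 = 1 := by simpa [hfs, finsetSum_coeff]
  have hgs0 : gs.coeff 0 = 1 := by simpa [hgs, finsetSum_coeff]
  have hfgs : ∀ k, f k * gs ∈ (mapRingHom R.subtype).range := fun k => by
    rw [hgs, Finset.mul_sum]
    exact sum_mem fun j _ => by
      rw [mul_left_comm]
      exact mul_mem (hC _ (hf j)) (hm k j)
  have hfsgs : fs * gs ∈ (mapRingHom R.subtype).range := by
    rw [hfs, Finset.sum_mul]
    exact sum_mem fun j _ => by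
      rw [mul_right_comm]
      exact mul_mem (hfgs j) (hC _ (hg j))
  have key : ∀ q : S[X], q.coeff 0 = 1 → q * gs ∈ (mapRingHom R.subtype).range →
      IsIntegral R (q.coeff n) := by
    rintro q hq ⟨p, hp⟩
    refine isIntegral_coeff_of_mul_eq_map (p := p) Subtype.val_injective hp ?_ hq n
    have := congrArg (fun p : S[X] => p.coeff 0) hp
    simp only [coe_mapRingHom, coeff_map, mul_coeff_zero, hq, hgs0, mul_one] at this
    exact Subtype.ext this
  have h1 := key (f i + C (1 - (f i).coeff 0) * fs) (by simp [hfs0]) (by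
    rw [add_mul, mul_assoc]
    exact add_mem (hfgs i) (mul_mem (hC _ (sub_mem (one_mem _) (hf i))) hfsgs))
  have h2 := key fs hfs0 hfsgs
  have h3 : IsIntegral R (1 - (f i).coeff 0) :=
    isIntegral_algebraMap (R := R) (x := ⟨_, sub_mem (one_mem _) (hf i)⟩)
  have h4 := h1.sub (h3.mul h2)
  rwa [coeff_add, coeff_C_mul, add_sub_cancel_right] at h4

/-- A rank one idempotent matrix over `R[X]` which factors over `S[X]`, with factors whose
constant terms lie in `R`, has all its factors in `R[X]` when `R` is subintegrally closed
in `S`. -/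
theorem Subring.IsSubintegrallyClosedIn.mem_range_mapRingHom {S ι : Type*} [CommRing S] [Fintype ι]
    {R : Subring S} (hcl : R.IsSubintegrallyClosedIn)
    (f g : ι → S[X]) (hm : ∀ i j, f i * g j ∈ (mapRingHom R.subtype).range)
    (hfg : ∑ i, f i * g i = 1) (hf : ∀ i, (f i).coeff 0 ∈ R) (hg : ∀ i, (g i).coeff 0 ∈ R)
    (j : ι) : f j ∈ (mapRingHom R.subtype).range := by
  let X : Finset S := Finset.univ.biUnion fun i => (f i).coeffs ∪ (g i).coeffs
  have hX : ∀ x ∈ X, IsIntegral R x := by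
    intro x hx
    simp only [X, Finset.mem_biUnion, Finset.mem_univ, true_and, Finset.mem_union,
      mem_coeffs_iff] at hx
    obtain ⟨i, ⟨n, -, rfl⟩ | ⟨n, -, rfl⟩⟩ := hx
    · exact isIntegral_coeff_of_sum_mul_eq_one R f g hm hfg hf hg i n
    · exact isIntegral_coeff_of_sum_mul_eq_one R g f (fun i j => mul_comm (g i) _ ▸ hm j i)
        (by simpa only [mul_comm] using hfg) hg hf i n
  let T : Subalgebra R S := Algebra.adjoin R (X : Set S)
  have hT : Module.Finite R T := .of_fg (fg_adjoin_of_finite X.finite_toSet hX)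
  have hlift : ∀ p : S[X], p.coeffs ⊆ X → ∃ q : T[X], q.map (algebraMap T S) = p := fun p hp =>
    (lifts_iff_coeff_lifts p).2 fun n => by
      rcases eq_or_ne (p.coeff n) 0 with h | h
      · exact ⟨0, by rw [h, map_zero]⟩
      · exact ⟨⟨_, Algebra.subset_adjoin (hp (coeff_mem_coeffs h))⟩, rfl⟩
  have hfT : ∀ i, ∃ q : T[X], q.map (algebraMap T S) = f i := fun i =>
    hlift _ (Finset.subset_union_left.trans
      (Finset.subset_biUnion_of_mem (fun i => (f i).coeffs ∪ (g i).coeffs) (Finset.mem_univ i)))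
  have hgT : ∀ i, ∃ q : T[X], q.map (algebraMap T S) = g i := fun i =>
    hlift _ (Finset.subset_union_right.trans
      (Finset.subset_biUnion_of_mem (fun i => (f i).coeffs ∪ (g i).coeffs) (Finset.mem_univ i)))
  choose F hF using hfT
  choose G hG using hgT
  have coeff_F : ∀ i n, ((F i).coeff n : S) = (f i).coeff n := fun i n => by
    rw [← hF i, coeff_map]; rfl
  have coeff_G : ∀ i n, ((G i).coeff n : S) = (g i).coeff n := fun i n => by
    rw [← hG i, coeff_map]; rfl
  choose m hm using hm
  have hinj : Function.Injective (mapRingHom (algebraMap T S)) :=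
    map_injective _ Subtype.val_injective
  have hFG : ∑ i, F i * G i = 1 := hinj <| by
    simpa only [map_sum, map_mul, map_one, coe_mapRingHom, hF, hG] using hfg
  have hFGm : ∀ i j, F i * G j = (m i j).map (algebraMap R T) := fun i j => hinj <| by
    rw [map_mul, coe_mapRingHom, hF, hG, ← hm, coe_mapRingHom, Polynomial.map_map]
    rfl
  have hsurj : Function.Surjective (algebraMap R T) := by
    refine algebraMap_surjective_of_forall_field ?_ (Subtype.val ⁻¹' X)
      (Algebra.adjoin_adjoin_coe_preimage) ?_
    · rintro c ⟨a, ha⟩ ⟨b, hb⟩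
      obtain ⟨d, hd⟩ : ∃ d : R, (d : S) = c :=
        ⟨⟨c, hcl c (by rw [← Subalgebra.coe_pow, ← ha]; exact a.2)
          (by rw [← Subalgebra.coe_pow, ← hb]; exact b.2)⟩, rfl⟩
      exact ⟨d, Subtype.ext hd⟩
    · intro K L _ _ _ _ r t hrt x hx
      have hrt' : ∀ x, t (algebraMap R T x) = algebraMap K L (r x) := fun x =>
        RingHom.congr_fun hrt x
      have hmKL : ∀ i j, ((m i j).map r).map (algebraMap K L) = (F i).map t * (G j).map t :=
        fun i j => by
          rw [← Polynomial.map_mul, hFGm, Polynomial.map_map, Polynomial.map_map, hrt]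
      have hsum : ∑ i, (F i).map t * (G i).map t = 1 := by
        simpa only [← coe_mapRingHom, map_sum, map_mul, map_one] using
          congrArg (mapRingHom t) hFG
      have hF0 : ∀ i, ((F i).map t).coeff 0 = algebraMap K L (r ⟨_, hf i⟩) := fun i => by
        rw [coeff_map, ← hrt']
        exact congrArg t (Subtype.ext (coeff_F i 0))
      have hG0 : ∀ i, ((G i).map t).coeff 0 = algebraMap K L (r ⟨_, hg i⟩) := fun i => by
        rw [coeff_map, ← hrt']
        exact congrArg t (Subtype.ext (coeff_G i 0))
      have hx' : (x : S) ∈ X := hx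
      simp only [X, Finset.mem_biUnion, Finset.mem_univ, true_and, Finset.mem_union,
        mem_coeffs_iff] at hx'
      obtain ⟨i, ⟨n, -, hn⟩ | ⟨n, -, hn⟩⟩ := hx'
      · obtain ⟨q, hq⟩ := exists_map_eq_of_isReduced _ _ _ _ _ hmKL hsum hF0 hG0 i
        refine ⟨q.coeff n, ?_⟩
        rw [← coeff_map, hq, coeff_map]
        exact congrArg t (Subtype.ext ((coeff_F i n).trans hn.symm))
      · obtain ⟨q, hq⟩ := exists_map_eq_of_isReduced _ _ (fun i j => (m j i).map r) _ _
          (fun i j => by rw [hmKL, mul_comm]) (by simpa only [mul_comm] using hsum) hG0 hF0 i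
        refine ⟨q.coeff n, ?_⟩
        rw [← coeff_map, hq, coeff_map]
        exact congrArg t (Subtype.ext ((coeff_G i n).trans hn.symm))
  refine (lifts_iff_coeff_lifts _).2 fun n => ?_
  obtain ⟨y, hy⟩ := hsurj ((F j).coeff n)
  exact ⟨y, (congrArg Subtype.val hy).trans (coeff_F j n)⟩

end PolynomialExtension

section Grading

/-- **Gordan's theorem** for finite families of vectors over `ℚ`. -/
theorem exists_dual_pos_of_forall_nonneg_relation {ι : Type*} (s : Finset ι) {V : Type*}
    [AddCommGroup V] [Module ℚ V] (v : ι → V)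
    (H : ∀ c : ι → ℚ, (∀ i ∈ s, 0 ≤ c i) → ∑ i ∈ s, c i • v i = 0 → ∀ i ∈ s, c i = 0) :
    ∃ φ : V →ₗ[ℚ] ℚ, ∀ i ∈ s, 0 < φ (v i) := by
  induction s using Finset.induction_on generalizing V with
  | empty => exact ⟨0, by simp⟩
  | insert a s ha ih =>
    have hne : ∀ i ∈ s, i ≠ a := fun i hi h => ha (h ▸ hi)
    have hsum : ∀ (c : ι → ℚ) (x : ℚ),
        ∑ i ∈ insert a s, Function.update c a x i • v i = x • v a + ∑ i ∈ s, c i • v i := by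
      intro c x
      rw [Finset.sum_insert ha, Function.update_self]
      congr 1
      exact Finset.sum_congr rfl fun i hi => by rw [Function.update_of_ne (hne i hi)]
    have H' : ∀ (c : ι → ℚ) (x : ℚ), 0 ≤ x → (∀ i ∈ s, 0 ≤ c i) →
        x • v a + ∑ i ∈ s, c i • v i = 0 → x = 0 ∧ ∀ i ∈ s, c i = 0 := by
      intro c x hx hc h
      have := H (Function.update c a x) (by
        intro i hi
        rcases Finset.mem_insert.1 hi with rfl | hi
        · simpa using hx
        · rw [Function.update_of_ne (hne i hi)]
          exact hc i hi) ((hsum c x).trans h)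
      refine ⟨by simpa using this a (Finset.mem_insert_self _ _), fun i hi => ?_⟩
      simpa [Function.update_of_ne (hne i hi)] using this i (Finset.mem_insert_of_mem hi)
    by_cases hq : ∀ c : ι → ℚ, (∀ i ∈ s, 0 ≤ c i) →
        ∑ i ∈ s, c i • (Submodule.span ℚ {v a}).mkQ (v i) = 0 → ∀ i ∈ s, c i = 0
    · obtain ⟨φ, hφ⟩ := ih _ hq
      have hva : v a ≠ 0 := fun h => one_ne_zero (H' 0 1 zero_le_one (by simp) (by simp [h])).1
      obtain ⟨ψ, hψ⟩ : ∃ ψ : V →ₗ[ℚ] ℚ, 0 < ψ (v a) := by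
        have := mt (Module.forall_dual_apply_eq_zero_iff ℚ (v a)).1 hva
        push Not at this
        obtain ⟨ψ, hψ⟩ := this
        rcases hψ.lt_or_gt with h | h
        · exact ⟨-ψ, by simpa using h⟩
        · exact ⟨ψ, h⟩
      obtain ⟨x, hx⟩ := (s.image fun i => -ψ (v i) / φ (Submodule.mkQ _ (v i))).exists_le
      refine ⟨(x + 1) • φ.comp (Submodule.mkQ _) + ψ, fun i hi => ?_⟩
      rcases Finset.mem_insert.1 hi with rfl | hi
      · have : (Submodule.span ℚ {v i}).mkQ (v i) = 0 := by
          simp [Submodule.mem_span_singleton_self]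
        simpa [-Submodule.mkQ_apply, this] using hψ
      · have h1 := hx _ (Finset.mem_image_of_mem _ hi)
        have h2 := hφ i hi
        rw [div_le_iff₀ h2] at h1
        simp only [LinearMap.add_apply, LinearMap.smul_apply, LinearMap.comp_apply, smul_eq_mul]
        linarith
    · push Not at hq
      obtain ⟨c, hc, h0, j, hj, hcj⟩ := hq
      simp only [← map_smul, ← map_sum] at h0
      rw [Submodule.mkQ_apply, Submodule.Quotient.mk_eq_zero,
        Submodule.mem_span_singleton] at h0
      obtain ⟨x, hx⟩ := h0
      have hx0 : 0 < x := by
        by_contra! h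
        exact hcj ((H' c (-x) (by linarith) hc (by rw [← hx, neg_smul, neg_add_cancel])).2 j hj)
      obtain ⟨φ, hφ⟩ := ih v fun c hc h => (H' c 0 le_rfl hc (by simpa using h)).2
      refine ⟨φ, fun i hi => ?_⟩
      rcases Finset.mem_insert.1 hi with rfl | hi
      · have h1 : x * φ (v i) = ∑ k ∈ s, c k * φ (v k) := by
          simpa using congrArg φ hx
        have h2 : 0 < ∑ k ∈ s, c k * φ (v k) :=
          Finset.sum_pos' (fun k hk => mul_nonneg (hc k hk) (hφ k hk).le)
            ⟨j, hj, mul_pos ((hc j hj).lt_of_ne' hcj) (hφ j hj)⟩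
        rw [← h1] at h2
        exact pos_of_mul_pos_right h2 hx0.le
      · exact hφ i hi

theorem exists_common_denominator_of_nonneg {ι : Type*} (s : Finset ι) (q : ι → ℚ)
    (hq : ∀ i ∈ s, 0 ≤ q i) :
    ∃ D : ℕ, 0 < D ∧ ∃ k : ι → ℕ, ∀ i ∈ s, (k i : ℚ) = D * q i := by
  refine ⟨∏ i ∈ s, (q i).den, Finset.prod_pos fun i _ => (q i).pos,
    fun i => (∏ j ∈ s.erase i, (q j).den) * (q i).num.toNat, fun i hi => ?_⟩
  have h1 : (((q i).num.toNat : ℕ) : ℚ) = (q i).den * q i := by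
    rw [Rat.den_mul_eq_num]
    exact_mod_cast Int.toNat_of_nonneg (Rat.num_nonneg.2 (hq i hi))
  rw [← Finset.prod_erase_mul _ _ hi]
  push_cast
  rw [h1, mul_assoc]

/-- A positive affine monoid has an `ℕ`-grading with trivial degree zero part. -/
theorem exists_degree {N : Type*} [CancelCommMonoid N] (htf : MulTorsionFree N)
    (hpos : IsPositiveMonoid N) (hfg : Monoid.FG N) :
    ∃ d : N →* Multiplicative ℕ, ∀ x, d x = 1 → x = 1 := by
  have : IsMulTorsionFree N := ⟨fun n hn x y h => htf x y n hn h⟩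
  obtain ⟨n, j, hj⟩ : ∃ (n : ℕ) (j : Additive N →+ (Fin n →₀ ℚ)), Function.Injective j := by
    refine ⟨AffineAddMonoid.dim (Additive N),
      (Finsupp.mapRange.addMonoidHom (Int.castAddHom ℚ)).comp
        ((FreeAbelianGroup.equivFinsupp _).toAddMonoidHom.comp
          (AffineAddMonoid.embedding (Additive N))), ?_⟩
    exact (Finsupp.mapRange_injective _ Int.cast_zero Int.cast_injective).comp
      ((FreeAbelianGroup.equivFinsupp _).injective.comp AffineAddMonoid.embedding_injective)
  obtain ⟨S, hS⟩ := hfg.fg_top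
  obtain ⟨φ, hφ⟩ := exists_dual_pos_of_forall_nonneg_relation (S.erase 1)
    (fun x => j (Additive.ofMul x)) (by
      intro c hc h x hx
      obtain ⟨D, hD, k, hk⟩ := exists_common_denominator_of_nonneg _ c hc
      have h1 : j (Additive.ofMul (∏ x ∈ S.erase 1, x ^ k x)) = 0 := by
        have h2 := congrArg ((D : ℚ) • ·) h
        simp only [Finset.smul_sum, smul_zero, smul_smul] at h2
        rw [ofMul_prod, map_sum, ← h2]
        refine Finset.sum_congr rfl fun y hy => ?_
        rw [← hk y hy, ofMul_pow, map_nsmul, Nat.cast_smul_eq_nsmul]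
      have h2 : ∏ x ∈ S.erase 1, x ^ k x = 1 :=
        Additive.ofMul.injective (hj (h1.trans (map_zero j).symm))
      have h3 : x ^ k x = 1 := hpos _ (isUnit_of_dvd_one (h2 ▸ Finset.dvd_prod_of_mem _ hx))
      have h4 : k x = 0 := by
        by_contra h4
        exact Finset.ne_of_mem_erase hx (htf x 1 (k x) h4 (by rw [h3, one_pow]))
      have h5 := hk x hx
      rw [h4, Nat.cast_zero, eq_comm, mul_eq_zero] at h5
      exact h5.resolve_left (by exact_mod_cast hD.ne'))
  obtain ⟨D, hD, k, hk⟩ := exists_common_denominator_of_nonneg (S.erase 1)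
    (fun x => φ (j (Additive.ofMul x))) (fun x hx => (hφ x hx).le)
  have hd : ∀ x : N, ∃ m : ℕ, (m : ℚ) = D * φ (j (Additive.ofMul x)) ∧ (m = 0 → x = 1) := by
    intro x
    have hx : x ∈ Submonoid.closure (S : Set N) := hS ▸ Submonoid.mem_top x
    induction hx using Submonoid.closure_induction with
    | mem x hx =>
      by_cases h1 : x = 1
      · exact ⟨0, by simp [h1], fun _ => h1⟩
      · have hx' := Finset.mem_erase.2 ⟨h1, hx⟩
        refine ⟨k x, hk x hx', fun h => ?_⟩
        have h5 := hk x hx'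
        have h6 : (0 : ℚ) < D * φ (j (Additive.ofMul x)) :=
          mul_pos (by exact_mod_cast hD) (hφ x hx')
        rw [h, Nat.cast_zero] at h5
        exact absurd h5 h6.ne
    | one => exact ⟨0, by simp, fun _ => rfl⟩
    | mul x y _ _ hx hy =>
      obtain ⟨m, hm, hm0⟩ := hx
      obtain ⟨l, hl, hl0⟩ := hy
      refine ⟨m + l, ?_, fun h => ?_⟩
      · rw [ofMul_mul, map_add, map_add, mul_add, ← hm, ← hl, Nat.cast_add]
      · rw [hm0 (by omega), hl0 (by omega), one_mul]
  choose d hd hd0 using hd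
  refine ⟨{ toFun := fun x => Multiplicative.ofAdd (d x), map_one' := ?_, map_mul' := ?_ },
    fun x hx => hd0 x hx⟩
  · have : (d 1 : ℚ) = 0 := by rw [hd]; simp
    rw [Nat.cast_eq_zero.1 this]
    rfl
  · intro x y
    have : (d (x * y) : ℚ) = (d x + d y : ℕ) := by
      rw [Nat.cast_add, hd, hd, hd, ofMul_mul, map_add, map_add, mul_add]
    rw [Nat.cast_injective this]
    rfl

end Grading

section SpanImage

variable {B B' B'' : Type*} [CommRing B] [CommRing B'] [CommRing B'']

/-- The `A'`-submodule of `B'` generated by the image of an `A`-submodule of `B`, as a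
multiplicative map, for a ring homomorphism `B →+* B'` mapping `A` to `A'`. -/
def Subring.spanImage {A : Subring B} {A' : Subring B'} (φ : B →+* B')
    (h : ∀ a ∈ A, φ a ∈ A') : Submodule A B →* Submodule A' B' where
  toFun I := Submodule.span A' (φ '' (I : Set B))
  map_one' := by
    refine le_antisymm (Submodule.span_le.2 ?_) (Submodule.one_le.2 ?_)
    · rintro _ ⟨x, hx, rfl⟩
      obtain ⟨a, rfl⟩ := Submodule.mem_one.1 hx
      exact Submodule.mem_one.2 ⟨⟨_, h a a.2⟩, rfl⟩
    · exact Submodule.subset_span ⟨1, Submodule.one_le.1 le_rfl, map_one φ⟩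
  map_mul' I J := by
    rw [Submodule.span_mul_span]
    refine le_antisymm (Submodule.span_le.2 ?_) (Submodule.span_le.2 ?_)
    · rintro _ ⟨x, hx, rfl⟩
      simp only [SetLike.mem_coe] at hx ⊢
      induction hx using Submodule.mul_induction_on' with
      | mem_mul_mem x hx y hy =>
        rw [map_mul]
        exact Submodule.subset_span (Set.mul_mem_mul ⟨x, hx, rfl⟩ ⟨y, hy, rfl⟩)
      | add x _ y _ hx hy =>
        rw [map_add]
        exact add_mem hx hy
    · rintro _ ⟨_, ⟨x, hx, rfl⟩, _, ⟨y, hy, rfl⟩, rfl⟩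
      exact Submodule.subset_span ⟨x * y, Submodule.mul_mem_mul hx hy, map_mul φ x y⟩

namespace Subring

theorem map_mem_spanImage {A : Subring B} {A' : Subring B'} (φ : B →+* B')
    (h : ∀ a ∈ A, φ a ∈ A') {I : Submodule A B} {x : B} (hx : x ∈ I) :
    φ x ∈ spanImage φ h I :=
  Submodule.subset_span ⟨x, hx, rfl⟩

theorem spanImage_spanImage_of_leftInverse {A : Subring B} {A' : Subring B'} {φ : B →+* B'}
    {ψ : B' →+* B} (h : ∀ a ∈ A, φ a ∈ A') (h' : ∀ a ∈ A', ψ a ∈ A)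
    (hψφ : Function.LeftInverse ψ φ) (I : Submodule A B) :
    spanImage ψ h' (spanImage φ h I) = I := by
  refine le_antisymm (Submodule.span_le.2 ?_) fun x hx => ?_
  · rintro _ ⟨x, hx, rfl⟩
    simp only [SetLike.mem_coe] at hx ⊢
    induction hx using Submodule.span_induction with
    | mem _ hx =>
      obtain ⟨y, hy, rfl⟩ := hx
      rwa [hψφ]
    | zero => rw [map_zero]; exact zero_mem _
    | add x y _ _ hx hy => rw [map_add]; exact add_mem hx hy
    | smul a x _ hx =>
      rw [Subring.smul_def, smul_eq_mul, map_mul]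
      exact I.smul_mem ⟨_, h' a a.2⟩ hx
  · have := map_mem_spanImage ψ h' (map_mem_spanImage φ h hx)
    rwa [hψφ] at this

end Subring

theorem Submodule.exists_sum_mul_eq_one {A : Subring B} {I J : Submodule A B} (h : I * J = 1) :
    ∃ (n : ℕ) (f g : Fin n → B), (∀ i, f i ∈ I) ∧ (∀ i, g i ∈ J) ∧ ∑ i, f i * g i = 1 := by
  have h1 : (1 : B) ∈ I * J := h ▸ Submodule.one_le.1 le_rfl
  rw [Submodule.mul_eq_span_mul_set, Submodule.mem_span_set'] at h1
  obtain ⟨n, c, x, hx⟩ := h1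
  choose f hf g hg hfg using fun i => Set.mem_mul.1 (x i).2
  refine ⟨n, fun i => c i • f i, g, fun i => I.smul_mem _ (hf i), hg, ?_⟩
  simpa only [smul_mul_assoc, hfg] using hx

open Polynomial in
/-- Homotopy invariance for subintegrally closed extensions: if `φ : S →+* S[X]` is a homotopy
from `id` (at `X = 1`) to an endomorphism (at `X = 0`) which maps the invertible `R`-modules `I`
and `J = I⁻¹` to `R`, then `I` is contained in `R`. -/
theorem Subring.IsSubintegrallyClosedIn.le_one_of_homotopy {S : Type*} [CommRing S] {R : Subring S}
    (hcl : R.IsSubintegrallyClosedIn) (φ : S →+* S[X])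
    (hφ : ∀ r ∈ R, φ r ∈ (mapRingHom R.subtype).range) (h1 : ∀ x, (φ x).eval 1 = x)
    {I J : Submodule R S} (hIJ : I * J = 1) (hI : ∀ x ∈ I, (φ x).coeff 0 ∈ R)
    (hJ : ∀ x ∈ J, (φ x).coeff 0 ∈ R) : I ≤ 1 := by
  have hmem : ∀ x : S, x ∈ (1 : Submodule R S) ↔ x ∈ R := fun x =>
    Submodule.mem_one.trans ⟨fun ⟨y, hy⟩ => hy ▸ y.2, fun hx => ⟨⟨x, hx⟩, rfl⟩⟩
  have hmul : ∀ x ∈ I, ∀ y ∈ J, x * y ∈ R := fun x hx y hy =>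
    (hmem _).1 (hIJ ▸ Submodule.mul_mem_mul hx hy)
  obtain ⟨n, f, g, hf, hg, hfg⟩ := Submodule.exists_sum_mul_eq_one hIJ
  have key : ∀ i, f i ∈ R := fun i => by
    obtain ⟨p, hp⟩ := hcl.mem_range_mapRingHom (fun i => φ (f i)) (fun i => φ (g i))
      (fun i j => by rw [← map_mul]; exact hφ _ (hmul _ (hf i) _ (hg j)))
      (by simp only [← map_mul, ← map_sum, hfg, map_one])
      (fun i => hI _ (hf i)) (fun i => hJ _ (hg i)) i
    have : f i = (p.eval 1 : R) := by
      rw [← h1 (f i), ← hp, coe_mapRingHom]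
      exact eval_one_map R.subtype p
    exact this ▸ (p.eval 1).2
  intro x hx
  rw [hmem, ← one_mul x, ← hfg, Finset.sum_mul]
  exact sum_mem fun i _ => by
    rw [mul_assoc, mul_comm (g i)]
    exact mul_mem (key i) (hmul x hx _ (hg i))

end SpanImage

section MonoidAlgebra

open Polynomial

variable {B : Type*} [CommRing B] {N : Type*} [CancelCommMonoid N]

/-- The ring homomorphism `B[N] →+* B[N][X]` with `b·n ↦ b·n·X ^ d n`. -/
def gradingHom (d : N →* Multiplicative ℕ) : MonoidAlgebra B N →+* (MonoidAlgebra B N)[X] :=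
  (MonoidAlgebra.lift B (MonoidAlgebra B N)[X] N
    { toFun := fun n => C (MonoidAlgebra.single n 1) * X ^ (d n).toAdd
      map_one' := by simp [← MonoidAlgebra.one_def]
      map_mul' := fun x y => by
        rw [← mul_one (1 : B), ← MonoidAlgebra.single_mul_single, map_mul, map_mul, toAdd_mul,
          pow_add, mul_one]
        ring }).toRingHom

/-- The projection `B[N] →+* B` onto the part of degree zero. -/
def degreeZeroHom (d : N →* Multiplicative ℕ) : MonoidAlgebra B N →+* B :=
  (MonoidAlgebra.lift B B N
    { toFun := fun n => 0 ^ (d n).toAdd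
      map_one' := by simp
      map_mul' := fun x y => by rw [map_mul, toAdd_mul, pow_add] }).toRingHom

theorem gradingHom_single (d : N →* Multiplicative ℕ) (n : N) (b : B) :
    gradingHom d (MonoidAlgebra.single n b) =
      C (MonoidAlgebra.single n b) * X ^ (d n).toAdd := by
  refine (MonoidAlgebra.lift_single _ n b).trans ?_
  change b • (C (MonoidAlgebra.single n (1 : B)) * X ^ (d n).toAdd) = _
  rw [← smul_mul_assoc, smul_C, MonoidAlgebra.smul_single, smul_eq_mul, mul_one]

theorem degreeZeroHom_single (d : N →* Multiplicative ℕ) (n : N) (b : B) :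
    degreeZeroHom d (MonoidAlgebra.single n b) = b * 0 ^ (d n).toAdd :=
  MonoidAlgebra.lift_single _ n b

theorem eval_one_gradingHom (d : N →* Multiplicative ℕ) (x : MonoidAlgebra B N) :
    (gradingHom d x).eval 1 = x := by
  have : (evalRingHom 1).comp (gradingHom d) = RingHom.id (MonoidAlgebra B N) :=
    MonoidAlgebra.ringHom_ext (by simp [gradingHom_single]) (by simp [gradingHom_single])
  exact RingHom.congr_fun this x

theorem coeff_zero_gradingHom (d : N →* Multiplicative ℕ) (hd : ∀ x, d x = 1 → x = 1)
    (x : MonoidAlgebra B N) :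
    (gradingHom d x).coeff 0 = MonoidAlgebra.singleOneRingHom (degreeZeroHom d x) := by
  have : constantCoeff.comp (gradingHom d) =
      (MonoidAlgebra.singleOneRingHom : B →+* MonoidAlgebra B N).comp (degreeZeroHom d) := by
    refine MonoidAlgebra.ringHom_ext
      (by simp [gradingHom_single, degreeZeroHom_single]) fun n => ?_
    by_cases hn : (d n).toAdd = 0
    · obtain rfl := hd n hn
      simp [gradingHom_single, degreeZeroHom_single]
    · simp [gradingHom_single, degreeZeroHom_single, hn, Ne.symm hn]
  exact RingHom.congr_fun this x

theorem map_mem_of_mem_monoidAlgebraSubring {S : Type*} [CommRing S] {A : Subring B}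
    {M : Submonoid N} {R : Subring S} (φ : MonoidAlgebra B N →+* S)
    (h : ∀ a ∈ A, ∀ m ∈ M, φ (MonoidAlgebra.single m a) ∈ R) :
    ∀ x ∈ monoidAlgebraSubring A M, φ x ∈ R := by
  have : monoidAlgebraSubring A M ≤ R.comap φ := by
    refine Subring.closure_le.2 ?_
    rintro _ ⟨a, ha, m, hm, rfl⟩
    exact h a ha m hm
  exact this

theorem single_mem_monoidAlgebraSubring {A : Subring B} {M : Submonoid N} {a : B} (ha : a ∈ A)
    {m : N} (hm : m ∈ M) : MonoidAlgebra.single m a ∈ monoidAlgebraSubring A M :=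
  Subring.subset_closure ⟨a, ha, m, hm, rfl⟩

theorem thetaIsIso_of_degree {A : Subring B} {M : Submonoid N} (d : N →* Multiplicative ℕ)
    (hd : ∀ x, d x = 1 → x = 1) (hcl : (monoidAlgebraSubring A M).IsSubintegrallyClosedIn) :
    ThetaIsIso A M := by
  set R := monoidAlgebraSubring A M
  let ι : B →+* MonoidAlgebra B N := MonoidAlgebra.singleOneRingHom
  let π : MonoidAlgebra B N →+* B := degreeZeroHom d
  have hι : ∀ a ∈ A, ι a ∈ R := fun a ha => single_mem_monoidAlgebraSubring ha M.one_mem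
  have hπ : ∀ x ∈ R, π x ∈ A := map_mem_of_mem_monoidAlgebraSubring π fun a ha m _ => by
    simp only [π, degreeZeroHom_single]
    exact mul_mem ha (pow_mem (zero_mem _) _)
  have hφ : ∀ x ∈ R, gradingHom d x ∈ (mapRingHom R.subtype).range :=
    map_mem_of_mem_monoidAlgebraSubring _ fun a ha m hm => by
      rw [gradingHom_single]
      exact ⟨C ⟨_, single_mem_monoidAlgebraSubring ha hm⟩ * X ^ (d m).toAdd, by simp⟩
  have hπι : Function.LeftInverse π ι := fun b => by
    simp [π, ι, degreeZeroHom_single]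
  let θ := Units.map (Subring.spanImage ι hι)
  let ρ := Units.map (Subring.spanImage π hπ)
  have hρθ : Function.LeftInverse ρ θ := fun I =>
    Units.ext (Subring.spanImage_spanImage_of_leftInverse hι hπ hπι _)
  have hle : ∀ W, ρ W = 1 → (W : Submodule R (MonoidAlgebra B N)) ≤ 1 := by
    have hmem : ∀ W, ρ W = 1 → ∀ x ∈ (W : Submodule R (MonoidAlgebra B N)),
        (gradingHom d x).coeff 0 ∈ R := fun W hW x hx => by
      rw [coeff_zero_gradingHom d hd]
      refine hι _ ?_
      have h1 : π x ∈ (1 : Submodule A B) := by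
        have := Subring.map_mem_spanImage π hπ hx
        rwa [show Subring.spanImage π hπ W = 1 from congrArg Units.val hW] at this
      obtain ⟨a, ha⟩ := Submodule.mem_one.1 h1
      exact ha ▸ a.2
    exact fun W hW => hcl.le_one_of_homotopy (gradingHom d) hφ (eval_one_gradingHom d)
      W.mul_inv (hmem W hW) (hmem W⁻¹ (by rw [map_inv, hW, inv_one]))
  have hker : ∀ W, ρ W = 1 → W = 1 := fun W hW => Units.ext <| by
    refine le_antisymm (hle W hW) ?_
    calc (1 : Submodule R (MonoidAlgebra B N)) = W * (W⁻¹ : (Submodule R _)ˣ) := W.mul_inv.symm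
      _ ≤ W * 1 := mul_le_mul_right (hle W⁻¹ (by rw [map_inv, hW, inv_one])) _
      _ = W := mul_one _
  have hθρ : Function.RightInverse ρ θ := fun W => by
    rw [eq_comm, ← mul_inv_eq_one]
    exact hker _ (by rw [map_mul, map_inv, hρθ, mul_inv_cancel])
  exact ⟨{ θ with invFun := ρ, left_inv := hρθ, right_inv := hθρ }, fun I => rfl⟩

end MonoidAlgebra

/-- **Sarwar, Theorem 1.2(a).**  If `A ⊆ B` is an extension of commutative rings, `M ⊆ N` an
extension of positive commutative cancellative torsion-free monoids with `N` affine (finitely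
generated), and `A[M]` is subintegrally closed in `B[N]`, then the canonical map
`θ : 𝓘(A,B) → 𝓘(A[M],B[N])` is an isomorphism. -/
theorem theta_isIso_of_subintegrallyClosed_monoidAlgebra
    {B : Type*} [CommRing B] (A : Subring B)
    {N : Type*} [CancelCommMonoid N] (M : Submonoid N)
    (htf : MulTorsionFree N) (hpos : IsPositiveMonoid N) (hfg : Monoid.FG N)
    (hcl : (monoidAlgebraSubring A M).IsSubintegrallyClosedIn) :
    ThetaIsIso A M := by
  obtain ⟨d, hd⟩ := exists_degree htf hpos hfg
  exact thetaIsIso_of_degree d hd hcl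
end
end

section
/- Let A ⊆ B be an extension of commutative rings and M a positive commutative cancellative torsion-free monoid. If A is subintegrally closed in B, then the canonical group homomorphism θ : 𝓘(A,B) → 𝓘(A[M],B[M]), sending an invertible A-submodule I of B to the A[M]-submodule of B[M] generated by I, is an isomorphism. (No reducedness assumption on B is needed.) -/
open scoped Classical

noncomputable section

/-- An element of a minimal prime `p` over `I` becomes nilpotent modulo `I` after localizing
at `p`. -/
theorem Ideal.exists_pow_mul_mem_of_mem_minimalPrimes {R : Type*} [CommRing R] {I p : Ideal R}
    (hp : p ∈ I.minimalPrimes) {r : R} (hr : r ∈ p) : ∃ z ∉ p, ∃ n : ℕ, r ^ n * z ∈ I := by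
  have hpp : p.IsPrime := hp.1.1
  by_contra! h
  obtain ⟨q, hq, hIq, hdisj⟩ := Ideal.exists_le_prime_disjoint I
    (Submonoid.powers r ⊔ p.primeCompl) (by
      rw [Set.disjoint_left]
      rintro a ha hs
      obtain ⟨_, ⟨n, rfl⟩, z, hz, rfl⟩ := Submonoid.mem_sup.1 hs
      exact h z hz n ha)
  rw [Set.disjoint_left] at hdisj
  have hqp : q ≤ p := by
    intro a ha
    by_contra hap
    exact hdisj ha (Submonoid.mem_sup_right hap)
  exact hdisj (hp.2 ⟨hq, hIq⟩ hqp hr) (Submonoid.mem_sup_left ⟨1, pow_one r⟩)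

open Polynomial in
/-- Over a field `K` and a reduced `K`-algebra `L`, a normalised invertible `K[X]`-submodule of
`L[X]`, given by generators `x` and generators `y` of its inverse, is contained in `K[X]`. -/
theorem Polynomial.mem_lifts_of_sum_mul_eq_one_of_field {K L ι : Type*} [Field K] [CommRing L]
    [IsReduced L] [Fintype ι] (f : K →+* L) (x y : ι → L[X])
    (hxy : ∀ i j, x i * y j ∈ lifts f) (hone : ∑ i, x i * y i = 1)
    (hx : ∀ i, (x i).coeff 0 ∈ f.range) (hy : ∀ i, (y i).coeff 0 ∈ f.range) (i : ι) :
    x i ∈ lifts f := by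
  set e : L[X] := ∑ i, C ((y i).coeff 0) * x i with he
  have he0 : e.coeff 0 = 1 := by
    have := congrArg (fun p : L[X] => p.coeff 0) hone
    simp only [finsetSum_coeff, mul_coeff_zero, coeff_one_zero] at this
    simp only [he, finsetSum_coeff, mul_coeff_zero, coeff_C_zero]
    rw [← this]
    exact Finset.sum_congr rfl fun i _ => mul_comm _ _
  have hreg : ∀ p q : L[X], e * p = e * q → p = q := by
    intro p q h
    have hu : IsUnit (e : PowerSeries L) := by
      rw [PowerSeries.isUnit_iff_constantCoeff]
      simp [he0]
    apply coe_injective L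
    apply hu.mul_left_cancel
    rw [← coe_mul, ← coe_mul, h]
  have hey : ∀ j, ∃ q : K[X], map f q = e * y j := by
    intro j
    rw [← mem_lifts, he, Finset.sum_mul]
    refine sum_mem fun k _ => ?_
    rw [mul_assoc]
    exact mul_mem (C'_mem_lifts (hy k)) (hxy k j)
  choose m hm using hey
  obtain ⟨g, hg⟩ := (IsPrincipalIdealRing.principal (Ideal.span (Set.range m))).principal
  have hgm : g ∈ Ideal.span (Set.range m) := by
    rw [hg]; exact Submodule.mem_span_singleton_self g
  obtain ⟨a, ha⟩ := (Ideal.mem_span_range_iff_exists_fun).1 hgm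
  have hq : ∀ j, ∃ q, m j = g * q := by
    intro j
    have : m j ∈ Ideal.span (Set.range m) := Ideal.subset_span ⟨j, rfl⟩
    rw [hg] at this
    exact Ideal.mem_span_singleton'.1 this |>.imp fun q hq => by rw [← hq, mul_comm]
  choose q hq using hq
  set v : L[X] := ∑ j, map f (a j) * y j with hv
  set u : L[X] := ∑ j, map f (q j) * x j with hu
  have hev : e * v = map f g := by
    rw [← ha, Polynomial.map_sum, hv, Finset.mul_sum]
    refine Finset.sum_congr rfl fun j _ => ?_
    rw [Polynomial.map_mul, hm]
    ring
  have huv : v * u = 1 := by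
    apply hreg
    rw [← mul_assoc, hev, mul_one, hu, Finset.mul_sum, ← mul_one e, ← hone, Finset.mul_sum]
    refine Finset.sum_congr rfl fun j _ => ?_
    rw [← mul_assoc, ← Polynomial.map_mul, ← hq, hm]
    ring
  have hu_lifts : u ∈ lifts f := by
    have hunit : IsUnit u := IsUnit.of_mul_eq_one_right _ huv
    have hC : u = C (u.coeff 0) := by
      ext n
      rcases Nat.eq_zero_or_pos n with rfl | hn
      · simp
      · rw [coeff_C_of_ne_zero hn.ne']
        exact ((isUnit_iff_coeff_isUnit_isNilpotent.1 hunit).2 n hn.ne').eq_zero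
    rw [hC]
    apply C'_mem_lifts
    change _ ∈ f.range
    rw [hu, finsetSum_coeff]
    refine sum_mem fun j _ => ?_
    rw [mul_coeff_zero, coeff_map]
    exact mul_mem ⟨_, rfl⟩ (hx j)
  have hxv : x i * v ∈ lifts f := by
    rw [hv, Finset.mul_sum]
    refine sum_mem fun j _ => ?_
    rw [mul_left_comm]
    exact mul_mem ((mem_lifts _).2 ⟨_, rfl⟩) (hxy i j)
  have := mul_mem hxv hu_lifts
  rwa [mul_assoc, huv, mul_one] at this

open Polynomial in
/-- Finite case of the triviality theorem: `S` is a finite `R`-algebra generated by the coefficients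
of `x` and `y`. -/
theorem Polynomial.surjective_algebraMap_of_sum_mul_eq_one {R S ι : Type*} [CommRing R]
    [CommRing S] [Algebra R S] [Module.Finite R S] [Fintype ι]
    (hsub : ∀ s : S, s ^ 2 ∈ (algebraMap R S).range → s ^ 3 ∈ (algebraMap R S).range →
      s ∈ (algebraMap R S).range)
    (x y : ι → S[X])
    (hgen : ∀ T : Subalgebra R S, (∀ i n, (x i).coeff n ∈ T) → (∀ i n, (y i).coeff n ∈ T) → T = ⊤)
    (hxy : ∀ i j, x i * y j ∈ lifts (algebraMap R S)) (hone : ∑ i, x i * y i = 1)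
    (hx : ∀ i, (x i).coeff 0 ∈ (algebraMap R S).range)
    (hy : ∀ i, (y i).coeff 0 ∈ (algebraMap R S).range) :
    Function.Surjective (algebraMap R S) := by
  let cond : Ideal S :=
    { carrier := {s | ∀ t, s * t ∈ (algebraMap R S).range}
      add_mem' := fun ha hb t => by rw [add_mul]; exact add_mem (ha t) (hb t)
      zero_mem' := fun t => by rw [zero_mul]; exact zero_mem _
      smul_mem' := fun c s hs t => by
        rw [smul_eq_mul, mul_comm c, mul_assoc]; exact hs _ }
  have hcond : ∀ s, s ∈ cond ↔ ∀ t, s * t ∈ (algebraMap R S).range := fun s => Iff.rfl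
  have hrad : cond.IsRadical := by
    refine Ideal.isRadical_iff_pow_one_lt 2 (by norm_num) |>.2 fun s hs t => ?_
    have h2 : ∀ t, s ^ 2 * t ∈ (algebraMap R S).range := hs
    refine hsub _ ?_ ?_
    · rw [mul_pow]; exact h2 _
    · rw [show (s * t) ^ 3 = s ^ 2 * (s * t ^ 3) by ring]; exact h2 _
  by_contra hns
  let I : Ideal R := cond.comap (algebraMap R S)
  have hI : I ≠ ⊤ := by
    intro h
    apply hns
    intro t
    have h1 : (1 : R) ∈ I := h ▸ Submodule.mem_top
    have h2 : algebraMap R S 1 * t ∈ (algebraMap R S).range := h1 t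
    rw [map_one, one_mul] at h2
    exact h2
  have hIrad : I.IsRadical := hrad.comap _
  obtain ⟨p, hp⟩ := Ideal.nonempty_minimalPrimes hI
  have hpp : p.IsPrime := hp.1.1
  have hIp : I ≤ p := hp.1.2
  -- the saturation of `cond` at `p`
  let J : Ideal S :=
    { carrier := {s | ∃ r ∉ p, algebraMap R S r * s ∈ cond}
      add_mem' := by
        rintro a b ⟨r, hr, ha⟩ ⟨r', hr', hb⟩
        refine ⟨r * r', fun h => (hpp.mem_or_mem h).elim hr hr', ?_⟩
        rw [map_mul, show algebraMap R S r * algebraMap R S r' * (a + b) =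
          algebraMap R S r' * (algebraMap R S r * a) + algebraMap R S r * (algebraMap R S r' * b)
          by ring]
        exact add_mem (cond.mul_mem_left _ ha) (cond.mul_mem_left _ hb)
      zero_mem' := ⟨1, fun h => hpp.ne_top ((Ideal.eq_top_iff_one _).2 h), by simp⟩
      smul_mem' := by
        rintro c s ⟨r, hr, hs⟩
        refine ⟨r, hr, ?_⟩
        rw [smul_eq_mul, mul_left_comm]
        exact cond.mul_mem_left _ hs }
  have hJ : ∀ s, s ∈ J ↔ ∃ r ∉ p, algebraMap R S r * s ∈ cond := fun s => Iff.rfl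
  have hJrad : J.IsRadical := by
    refine Ideal.isRadical_iff_pow_one_lt 2 (by norm_num) |>.2 ?_
    rintro s ⟨r, hr, hs⟩
    refine ⟨r, hr, hrad ⟨2, ?_⟩⟩
    rw [mul_pow, pow_two, mul_assoc]
    exact cond.mul_mem_left _ hs
  have hpJ : ∀ r ∈ p, algebraMap R S r ∈ J := by
    intro r hr
    obtain ⟨z, hz, n, hzn⟩ := Ideal.exists_pow_mul_mem_of_mem_minimalPrimes hp hr
    refine ⟨z, hz, ?_⟩
    rw [← map_mul]
    refine hIrad ⟨n + 1, ?_⟩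
    rw [show (z * r) ^ (n + 1) = z ^ n * r * (r ^ n * z) by ring]
    exact I.mul_mem_left _ hzn
  have : IsReduced (S ⧸ J) := (Ideal.isRadical_iff_quotient_reduced _).1 hJrad
  let π : R →+* S ⧸ J := (Ideal.Quotient.mk J).comp (algebraMap R S)
  let T : Submonoid (S ⧸ J) := p.primeCompl.map π
  let D := Localization T
  let g : S →+* D := (algebraMap (S ⧸ J) D).comp (Ideal.Quotient.mk J)
  have hg0 : ∀ s, g s = 0 → s ∈ J := by
    intro s hs
    obtain ⟨⟨_, r, hr, rfl⟩, ht⟩ := (IsLocalization.map_eq_zero_iff T D _).1 hs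
    have : algebraMap R S r * s ∈ J := by
      rw [← Ideal.Quotient.eq_zero_iff_mem, map_mul]; exact ht
    obtain ⟨r', hr', h⟩ := this
    refine ⟨r' * r, fun h => (hpp.mem_or_mem h).elim hr' hr, ?_⟩
    rwa [map_mul, mul_assoc]
  let f₀ : R ⧸ p →+* D := Ideal.Quotient.lift p (g.comp (algebraMap R S)) (by
    intro r hr
    change algebraMap (S ⧸ J) D (Ideal.Quotient.mk J _) = 0
    rw [Ideal.Quotient.eq_zero_iff_mem.2 (hpJ r hr), map_zero])
  have hf₀ : ∀ r : R, f₀ (Ideal.Quotient.mk p r) = g (algebraMap R S r) := fun r => rfl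
  have hunit : ∀ d : nonZeroDivisors (R ⧸ p), IsUnit (f₀ d) := by
    rintro ⟨d, hd⟩
    obtain ⟨r, rfl⟩ := Ideal.Quotient.mk_surjective d
    have hr : r ∉ p := fun h =>
      nonZeroDivisors.ne_zero hd (Ideal.Quotient.eq_zero_iff_mem.2 h)
    exact IsLocalization.map_units D (⟨π r, r, hr, rfl⟩ : T)
  let f : FractionRing (R ⧸ p) →+* D := IsLocalization.lift hunit
  have hfR : ∀ r : R, g (algebraMap R S r) ∈ f.range := fun r =>
    ⟨algebraMap (R ⧸ p) _ (Ideal.Quotient.mk p r), by rw [IsLocalization.lift_eq]; rfl⟩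
  have hlift : ∀ P ∈ lifts (algebraMap R S), P.map g ∈ lifts f := by
    intro P hP
    rw [lifts_iff_coeff_lifts] at hP ⊢
    intro n
    obtain ⟨r, hr⟩ := hP n
    rw [coeff_map, ← hr]
    exact hfR r
  have hg : ∀ s : S, g s ∈ Set.range f → ∃ r ∉ p, algebraMap R S r * s ∈ (algebraMap R S).range := by
    rintro s ⟨k, hk⟩
    obtain ⟨⟨a, d⟩, hd⟩ := IsLocalization.surj (nonZeroDivisors (R ⧸ p)) k
    obtain ⟨⟨d, hdn⟩, rfl⟩ : ∃ d', d' = d := ⟨_, rfl⟩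
    obtain ⟨a, rfl⟩ := Ideal.Quotient.mk_surjective a
    obtain ⟨d, rfl⟩ := Ideal.Quotient.mk_surjective d
    have hdp : d ∉ p := fun h =>
      nonZeroDivisors.ne_zero hdn (Ideal.Quotient.eq_zero_iff_mem.2 h)
    have h := congrArg f hd
    rw [map_mul, hk, IsLocalization.lift_eq, IsLocalization.lift_eq, hf₀, hf₀, ← map_mul,
      ← sub_eq_zero, ← map_sub] at h
    obtain ⟨r, hr, hrs⟩ := hg0 _ h
    refine ⟨r * d, fun h => (hpp.mem_or_mem h).elim hr hdp, ?_⟩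
    have := (hcond _).1 hrs 1
    rw [mul_one, mul_sub, ← map_mul] at this
    have := add_mem this (RingHom.mem_range_self (algebraMap R S) (r * a))
    rw [sub_add_cancel] at this
    rwa [map_mul, mul_assoc, mul_comm (algebraMap R S d)]
  have hone' : ∑ i, (x i).map g * (y i).map g = 1 := by
    simp_rw [← Polynomial.map_mul, ← Polynomial.map_sum, hone, Polynomial.map_one]
  have hxy' : ∀ i j, (x i).map g * (y j).map g ∈ lifts f := fun i j => by
    rw [← Polynomial.map_mul]; exact hlift _ (hxy i j)
  have hcoeff : ∀ z : ι → S[X], (∀ i, (z i).coeff 0 ∈ (algebraMap R S).range) →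
      ∀ i, ((z i).map g).coeff 0 ∈ f.range := by
    intro z hz i
    obtain ⟨r, hr⟩ := hz i
    rw [coeff_map, ← hr]
    exact hfR r
  have hX := mem_lifts_of_sum_mul_eq_one_of_field f (fun i => (x i).map g) (fun i => (y i).map g)
    hxy' hone' (hcoeff x hx) (hcoeff y hy)
  have hY := mem_lifts_of_sum_mul_eq_one_of_field f (fun i => (y i).map g) (fun i => (x i).map g)
    (fun i j => mul_comm ((x j).map g) _ ▸ hxy' j i)
    ((Finset.sum_congr rfl fun i _ => mul_comm _ _).trans hone') (hcoeff y hy) (hcoeff x hx)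
  let U : Subalgebra R S :=
    { carrier := {s | ∃ r ∉ p, algebraMap R S r * s ∈ (algebraMap R S).range}
      mul_mem' := by
        rintro a b ⟨r, hr, ha⟩ ⟨r', hr', hb⟩
        refine ⟨r * r', fun h => (hpp.mem_or_mem h).elim hr hr', ?_⟩
        rw [map_mul, mul_mul_mul_comm]
        exact mul_mem ha hb
      add_mem' := by
        rintro a b ⟨r, hr, ha⟩ ⟨r', hr', hb⟩
        refine ⟨r * r', fun h => (hpp.mem_or_mem h).elim hr hr', ?_⟩
        rw [map_mul, show algebraMap R S r * algebraMap R S r' * (a + b) =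
          algebraMap R S r' * (algebraMap R S r * a) + algebraMap R S r * (algebraMap R S r' * b)
          by ring]
        exact add_mem (mul_mem ⟨_, rfl⟩ ha) (mul_mem ⟨_, rfl⟩ hb)
      algebraMap_mem' := fun r => ⟨1, fun h => hpp.ne_top ((Ideal.eq_top_iff_one _).2 h),
        by rw [← map_mul]; exact ⟨_, rfl⟩⟩ }
  have hU : U = ⊤ := by
    refine hgen U (fun i n => hg _ ?_) (fun i n => hg _ ?_)
    · rw [← coeff_map]; exact (lifts_iff_coeff_lifts _).1 (hX i) n
    · rw [← coeff_map]; exact (lifts_iff_coeff_lifts _).1 (hY i) n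
  obtain ⟨G, hG⟩ := Module.Finite.fg_top (R := R) (M := S)
  have hmemU : ∀ s : S, ∃ r ∉ p, algebraMap R S r * s ∈ (algebraMap R S).range := fun s =>
    (hU ▸ Algebra.mem_top : s ∈ U)
  choose ρ hρp hρ using hmemU
  have hprod : ∏ s ∈ G, ρ s ∉ p := by
    rw [hpp.prod_mem_iff]
    push Not
    exact fun s _ => hρp s
  refine hprod (hIp fun t => ?_)
  have ht : t ∈ Submodule.span R (G : Set S) := hG ▸ Submodule.mem_top
  induction ht using Submodule.span_induction with
  | mem s hs =>
    rw [← Finset.prod_erase_mul _ _ hs, map_mul, mul_assoc]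
    exact mul_mem ⟨_, rfl⟩ (hρ s)
  | zero => rw [mul_zero]; exact zero_mem _
  | add a b _ _ ha hb => rw [mul_add]; exact add_mem ha hb
  | smul r a _ ha =>
    rw [Algebra.smul_def, mul_left_comm]
    exact mul_mem ⟨_, rfl⟩ ha

open Polynomial in
/-- A factor with constant coefficient `1` of a polynomial over `R` has integral coefficients, as
soon as the cofactor also has constant coefficient `1`. -/
theorem Polynomial.isIntegral_coeff_of_mul_mem_lifts {R S : Type*} [CommRing R] [CommRing S]
    [Algebra R S] {p q : S[X]} (hp : p.coeff 0 = 1) (hq : q.coeff 0 = 1)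
    (hpq : p * q ∈ lifts (algebraMap R S)) (n : ℕ) : IsIntegral R (p.coeff n) := by
  cases subsingleton_or_nontrivial S
  · rw [Subsingleton.elim (p.coeff n) 0]; exact isIntegral_zero
  have hmonic : ∀ r : S[X], r.coeff 0 = 1 → ∀ F, r.natDegree ≤ F → (reflect F r).Monic := by
    intro r hr F hF
    refine monic_of_natDegree_le_of_coeff_eq_one F ?_ ?_
    · exact natDegree_reflect_le.trans (by simp [hF])
    · rw [coeff_reflect, revAt_le le_rfl, Nat.sub_self, hr]
  have hmul : reflect (p.natDegree + q.natDegree) (p * q) =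
      reflect p.natDegree p * reflect q.natDegree q := reflect_mul _ _ le_rfl le_rfl
  have hl : reflect (p.natDegree + q.natDegree) (p * q) ∈ lifts (algebraMap R S) := by
    rw [lifts_iff_coeff_lifts] at hpq ⊢
    intro k
    rw [coeff_reflect]
    exact hpq _
  obtain ⟨P, hP, -, hPm⟩ := lifts_and_degree_eq_and_monic hl
    (hmonic _ (by rw [mul_coeff_zero, hp, hq, mul_one]) _ natDegree_mul_le)
  have := isIntegral_coeff_of_dvd P _ hPm (hmonic p hp _ le_rfl) ⟨_, hP.trans hmul⟩
    (revAt p.natDegree n)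
  rwa [coeff_reflect, revAt_invol] at this

open Polynomial in
theorem Polynomial.isIntegral_coeff_of_sum_mul_eq_one {R S ι : Type*} [CommRing R]
    [CommRing S] [Algebra R S] [Fintype ι] (x y : ι → S[X])
    (hxy : ∀ i j, x i * y j ∈ lifts (algebraMap R S)) (hone : ∑ i, x i * y i = 1)
    (hx : ∀ i, (x i).coeff 0 ∈ (algebraMap R S).range)
    (hy : ∀ i, (y i).coeff 0 ∈ (algebraMap R S).range) (i : ι) (n : ℕ) :
    IsIntegral R ((x i).coeff n) := by
  have hone0 : ∑ i, (x i).coeff 0 * (y i).coeff 0 = 1 := by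
    have := congrArg (fun p : S[X] => p.coeff 0) hone
    simpa only [finsetSum_coeff, mul_coeff_zero, coeff_one_zero] using this
  set e : S[X] := ∑ k, C ((y k).coeff 0) * x k with he
  set f : S[X] := ∑ k, C ((x k).coeff 0) * y k with hf
  have he0 : e.coeff 0 = 1 := by
    simp only [he, finsetSum_coeff, mul_coeff_zero, coeff_C_zero]
    exact (Finset.sum_congr rfl fun i _ => mul_comm _ _).trans hone0
  have hf0 : f.coeff 0 = 1 := by
    simp only [hf, finsetSum_coeff, mul_coeff_zero, coeff_C_zero]
    exact hone0
  have hxf : ∀ k, x k * f ∈ lifts (algebraMap R S) := by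
    intro k
    rw [hf, Finset.mul_sum]
    refine sum_mem fun l _ => ?_
    rw [mul_left_comm]
    exact mul_mem (C'_mem_lifts (hx l)) (hxy k l)
  have hef : e * f ∈ lifts (algebraMap R S) := by
    rw [he, Finset.sum_mul]
    refine sum_mem fun l _ => ?_
    rw [mul_assoc]
    exact mul_mem (C'_mem_lifts (hy l)) (hxf l)
  have key := isIntegral_coeff_of_mul_mem_lifts (R := R) (p := e + X ^ (e.natDegree + 1) * x i)
    (q := f) (by simp [he0]) hf0
    (by
      rw [add_mul, mul_assoc]
      exact add_mem hef (mul_mem (X_pow_mem_lifts _ _) (hxf i))) (n + (e.natDegree + 1))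
  rwa [coeff_add, coeff_X_pow_mul, coeff_eq_zero_of_natDegree_lt (by lia), zero_add] at key

open Polynomial in
/-- If `A` is subintegrally closed in `B`, then a normalised invertible `A[X]`-submodule of `B[X]`,
given by generators `x` and generators `y` of its inverse, is contained in `A[X]`. -/
theorem Subring.IsSubintegrallyClosedIn.coeff_mem_of_sum_mul_eq_one {B ι : Type*} [CommRing B]
    {A : Subring B} (hA : A.IsSubintegrallyClosedIn) [Fintype ι] (x y : ι → B[X])
    (hxy : ∀ i j n, (x i * y j).coeff n ∈ A) (hone : ∑ i, x i * y i = 1)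
    (hx : ∀ i, (x i).coeff 0 ∈ A) (hy : ∀ i, (y i).coeff 0 ∈ A) (i : ι) (n : ℕ) :
    (x i).coeff n ∈ A := by
  have hmem : ∀ p : B[X], p ∈ lifts (algebraMap A B) ↔ ∀ n, p.coeff n ∈ A := by
    intro p
    rw [lifts_iff_coeff_lifts]
    refine forall_congr' fun n => ⟨?_, fun h => ⟨⟨_, h⟩, rfl⟩⟩
    rintro ⟨a, ha⟩
    rw [← ha]
    exact a.2
  have hX := isIntegral_coeff_of_sum_mul_eq_one (R := A) x y
    (fun i j => (hmem _).2 (hxy i j)) hone (fun i => ⟨⟨_, hx i⟩, rfl⟩) (fun i => ⟨⟨_, hy i⟩, rfl⟩)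
  have hY := isIntegral_coeff_of_sum_mul_eq_one (R := A) y x
    (fun i j => (hmem _).2 (mul_comm (x j) (y i) ▸ hxy j i))
    ((Finset.sum_congr rfl fun i _ => mul_comm _ _).trans hone)
    (fun i => ⟨⟨_, hy i⟩, rfl⟩) (fun i => ⟨⟨_, hx i⟩, rfl⟩)
  let G : Set B := ⋃ i, ((x i).coeffs ∪ (y i).coeffs : Set B)
  have hGfin : G.Finite := Set.finite_iUnion fun i =>
    (Finset.finite_toSet _).union (Finset.finite_toSet _)
  have hGint : ∀ b ∈ G, IsIntegral A b := by
    rintro b hb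
    obtain ⟨i, hb | hb⟩ := Set.mem_iUnion.1 hb
    · obtain ⟨n, -, rfl⟩ := mem_coeffs_iff.1 (Finset.mem_coe.1 hb)
      exact hX i n
    · obtain ⟨n, -, rfl⟩ := mem_coeffs_iff.1 (Finset.mem_coe.1 hb)
      exact hY i n
  let S : Subalgebra A B := Algebra.adjoin A G
  have : Module.Finite A S := Module.Finite.of_fg (fg_adjoin_of_finite hGfin hGint)
  have hcoeff : ∀ (T : Subalgebra A B), G ⊆ T ↔
      (∀ i n, (x i).coeff n ∈ T) ∧ ∀ i n, (y i).coeff n ∈ T := by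
    intro T
    have hc : ∀ p : B[X], (p.coeffs : Set B) ⊆ T ↔ ∀ n, p.coeff n ∈ T := by
      intro p
      constructor
      · intro h n
        by_cases hn : p.coeff n = 0
        · rw [hn]; exact zero_mem _
        · exact h (coeff_mem_coeffs hn)
      · intro h b hb
        obtain ⟨n, -, rfl⟩ := mem_coeffs_iff.1 (Finset.mem_coe.1 hb)
        exact h n
    simp only [G, Set.iUnion_subset_iff, Set.union_subset_iff, hc, forall_and]
  obtain ⟨hxS, hyS⟩ := (hcoeff S).1 Algebra.subset_adjoin
  have hlift : ∀ z : ι → B[X], (∀ i n, (z i).coeff n ∈ S) →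
      ∃ z' : ι → S[X], ∀ i, (z' i).map S.val.toRingHom = z i := by
    intro z hz
    have : ∀ i, ∃ q : S[X], q.map S.val.toRingHom = z i := fun i => by
      rw [← mem_lifts, lifts_iff_coeff_lifts]
      exact fun n => ⟨⟨_, hz i n⟩, rfl⟩
    choose z' hz' using this
    exact ⟨z', hz'⟩
  obtain ⟨x', hx'⟩ := hlift x hxS
  obtain ⟨y', hy'⟩ := hlift y hyS
  have hxc : ∀ i n, ((x' i).coeff n : B) = (x i).coeff n := fun i n => by
    rw [← hx', coeff_map]; rfl
  have hyc : ∀ i n, ((y' i).coeff n : B) = (y i).coeff n := fun i n => by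
    rw [← hy', coeff_map]; rfl
  have hrange : ∀ s : S, s ∈ (algebraMap A S).range ↔ (s : B) ∈ A := by
    intro s
    constructor
    · rintro ⟨a, rfl⟩
      exact a.2
    · exact fun h => ⟨⟨_, h⟩, rfl⟩
  have hinj : Function.Injective S.val.toRingHom := Subtype.val_injective
  have hsurj := surjective_algebraMap_of_sum_mul_eq_one (R := A) (S := S)
    (fun s h2 h3 => (hrange s).2 (hA _ ((hrange _).1 h2) ((hrange _).1 h3))) x' y'
    (by
      intro T hTx hTy
      have hle : S ≤ T.map S.val := by
        refine Algebra.adjoin_le ((hcoeff _).2 ⟨fun i n => ?_, fun i n => ?_⟩)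
        · exact ⟨_, hTx i n, hxc i n⟩
        · exact ⟨_, hTy i n, hyc i n⟩
      rw [eq_top_iff]
      intro s _
      obtain ⟨t, ht, hts⟩ := hle s.2
      rwa [← Subtype.val_injective hts])
    (by
      intro i j
      rw [lifts_iff_coeff_lifts]
      intro n
      change _ ∈ (algebraMap A S).range
      rw [hrange]
      have := hxy i j n
      rw [← hx', ← hy', ← Polynomial.map_mul, coeff_map] at this
      exact this)
    (by
      apply map_injective _ hinj
      rw [Polynomial.map_sum, Polynomial.map_one, ← hone]
      exact Finset.sum_congr rfl fun i _ => by rw [Polynomial.map_mul, hx', hy'])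
    (fun i => (hrange _).2 (hxc i 0 ▸ hx i)) (fun i => (hrange _).2 (hyc i 0 ▸ hy i))
  rw [← hxc]
  exact (hrange _).1 (hsurj _)

open Filter Topology in
theorem eventually_pos_add_mul {ι : Type*} (T : Finset ι) (a b : ι → ℚ) (ha : ∀ i ∈ T, 0 < a i) :
    ∀ᶠ ε : ℚ in 𝓝[>] 0, ∀ i ∈ T, 0 < a i + ε * b i := by
  rw [Finset.eventually_all]
  intro i hi
  have : Tendsto (fun ε : ℚ => a i + ε * b i) (𝓝 0) (𝓝 (a i + 0 * b i)) :=
    Continuous.tendsto (by fun_prop) 0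
  rw [zero_mul, add_zero] at this
  exact (this.mono_left nhdsWithin_le_nhds).eventually_const_lt (ha i hi)

open Filter Topology in
theorem eventually_add_mul_ne_zero {ι : Type*} (T : Finset ι) (a b : ι → ℚ)
    (hb : ∀ i ∈ T, b i ≠ 0) : ∀ᶠ ε : ℚ in 𝓝[>] 0, ∀ i ∈ T, a i + ε * b i ≠ 0 := by
  rw [Finset.eventually_all]
  intro i hi
  by_cases hai : a i = 0
  · filter_upwards [self_mem_nhdsWithin] with ε hε
    rw [hai, zero_add]
    exact mul_ne_zero (Set.mem_Ioi.1 hε).ne' (hb i hi)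
  · have : Tendsto (fun ε : ℚ => a i + ε * b i) (𝓝 0) (𝓝 (a i + 0 * b i)) :=
      Continuous.tendsto (by fun_prop) 0
    rw [zero_mul, add_zero] at this
    exact (this.mono_left nhdsWithin_le_nhds).eventually_ne hai

open Filter Topology in
theorem exists_pos_forall_pos_add_mul {ι : Type*} (T : Finset ι) (a b : ι → ℚ)
    (ha : ∀ i ∈ T, 0 < a i) : ∃ ε : ℚ, 0 < ε ∧ ∀ i ∈ T, 0 < a i + ε * b i :=
  ((eventually_pos_add_mul T a b ha).and self_mem_nhdsWithin).exists.imp fun _ h => h.symm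

/-- **Gordan's theorem**: a finite family of vectors over `ℚ` without nontrivial nonnegative
relations lies in an open half-space. -/
theorem exists_linearMap_pos_of_forall_nonneg_relation {ι : Type*} (T : Finset ι) :
    ∀ {V : Type*} [AddCommGroup V] [Module ℚ V] (s : ι → V),
      (∀ c : ι → ℚ, (∀ i ∈ T, 0 ≤ c i) → ∑ i ∈ T, c i • s i = 0 → ∀ i ∈ T, c i = 0) →
      ∃ f : V →ₗ[ℚ] ℚ, ∀ i ∈ T, 0 < f (s i) := by
  induction T using Finset.induction_on with
  | empty => exact fun s _ => ⟨0, by simp⟩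
  | insert a T ha ih =>
    intro V _ _ s hs
    have hextend : ∀ (c : ι → ℚ) (r : ℚ), (∀ i ∈ T, 0 ≤ c i) → 0 ≤ r →
        r • s a + ∑ i ∈ T, c i • s i = 0 → r = 0 ∧ ∀ i ∈ T, c i = 0 := by
      intro c r hc hr h
      have hne : ∀ i ∈ T, i ≠ a := fun i hi h => ha (h ▸ hi)
      have := hs (Function.update c a r) (by
        intro i hi
        rcases Finset.mem_insert.1 hi with rfl | hi
        · simpa
        · rw [Function.update_of_ne (hne i hi)]; exact hc i hi)
        (by
          rw [Finset.sum_insert ha, Function.update_self, ← h]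
          congr 1
          exact Finset.sum_congr rfl fun i hi => by rw [Function.update_of_ne (hne i hi)])
      refine ⟨by simpa using this a (Finset.mem_insert_self _ _), fun i hi => ?_⟩
      simpa [Function.update_of_ne (hne i hi)] using this i (Finset.mem_insert_of_mem hi)
    by_cases hcone : ∃ c : ι → ℚ, (∀ i ∈ T, 0 ≤ c i) ∧ s a = ∑ i ∈ T, c i • s i
    · obtain ⟨c, hc, hca⟩ := hcone
      obtain ⟨f, hf⟩ := ih s (fun c hc h => (hextend c 0 hc le_rfl (by simpa using h)).2)
      refine ⟨f, fun i hi => ?_⟩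
      rcases Finset.mem_insert.1 hi with rfl | hi
      · rw [hca, map_sum]
        simp only [map_smul, smul_eq_mul]
        refine (Finset.sum_nonneg fun j hj => mul_nonneg (hc j hj) (hf j hj).le).lt_of_ne' ?_
        intro h0
        have hz := (Finset.sum_eq_zero_iff_of_nonneg
          fun j hj => mul_nonneg (hc j hj) (hf j hj).le).1 h0
        have hc0 : ∀ j ∈ T, c j = 0 := fun j hj =>
          (mul_eq_zero.1 (hz j hj)).resolve_right (hf j hj).ne'
        have hsi : s i = 0 := by
          rw [hca]
          exact Finset.sum_eq_zero fun j hj => by rw [hc0 j hj, zero_smul]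
        exact one_ne_zero (hextend 0 1 (by simp) zero_le_one (by simp [hsi])).1
      · exact hf i hi
    · let W : Submodule ℚ V := Submodule.span ℚ {s a}
      obtain ⟨f, hf⟩ := ih (fun i => W.mkQ (s i)) (by
        intro c hc h
        simp only [← map_smul, ← map_sum] at h
        rw [Submodule.mkQ_apply, Submodule.Quotient.mk_eq_zero] at h
        obtain ⟨r, hr⟩ := Submodule.mem_span_singleton.1 h
        rcases le_or_gt r 0 with hr0 | hr0
        · exact (hextend c (-r) hc (neg_nonneg.2 hr0) (by rw [← hr]; simp)).2
        · refine absurd ⟨fun i => r⁻¹ * c i, fun i hi => ?_, ?_⟩ hcone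
          · exact mul_nonneg (inv_nonneg.2 hr0.le) (hc i hi)
          · simp only [mul_smul]
            rw [← Finset.smul_sum, ← hr, smul_smul, inv_mul_cancel₀ hr0.ne', one_smul])
      have hsa : s a ≠ 0 := fun h =>
        one_ne_zero (hextend 0 1 (by simp) zero_le_one (by simp [h])).1
      obtain ⟨g, hg⟩ : ∃ g : V →ₗ[ℚ] ℚ, 0 < g (s a) := by
        obtain ⟨g, hg⟩ := Module.exists_dual_forall_apply_ne_zero (K := ℚ)
          (fun _ : Unit => s a) (fun _ => hsa)
        rcases lt_or_gt_of_ne (hg ()) with h | h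
        · exact ⟨-g, by simpa using h⟩
        · exact ⟨g, h⟩
      obtain ⟨ε, hε, hpos⟩ := exists_pos_forall_pos_add_mul T (fun i => f (W.mkQ (s i)))
        (fun i => g (s i)) hf
      refine ⟨f.comp W.mkQ + ε • g, fun i hi => ?_⟩
      rcases Finset.mem_insert.1 hi with rfl | hi
      · have : W.mkQ (s i) = 0 := by
          rw [Submodule.mkQ_apply, Submodule.Quotient.mk_eq_zero]
          exact Submodule.mem_span_singleton_self _
        simp only [LinearMap.add_apply, LinearMap.comp_apply, this, map_zero, zero_add,
          LinearMap.smul_apply, smul_eq_mul]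
        exact mul_pos hε hg
      · exact hpos i hi

theorem AffineAddMonoid.exists_injective_finsupp_rat (P : Type*) [AddCancelCommMonoid P]
    [AddMonoid.FG P] [IsAddTorsionFree P] :
    ∃ j : P →+ (Fin (AffineAddMonoid.dim P) →₀ ℚ), Function.Injective j := by
  refine ⟨(Finsupp.mapRange.addMonoidHom (Int.castAddHom ℚ)).comp
    ((FreeAbelianGroup.equivFinsupp _).toAddMonoidHom.comp (AffineAddMonoid.embedding P)), ?_⟩
  exact (Finsupp.mapRange_injective _ (by simp) Int.cast_injective).comp
    ((FreeAbelianGroup.equivFinsupp _).injective.comp AffineAddMonoid.embedding_injective)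

theorem exists_pos_forall_exists_natCast_eq_mul {ι : Type*} (T : Finset ι) (q : ι → ℚ)
    (hq : ∀ i ∈ T, 0 ≤ q i) : ∃ k : ℕ, 0 < k ∧ ∀ i ∈ T, ∃ n : ℕ, (n : ℚ) = k * q i := by
  refine ⟨∏ i ∈ T, (q i).den, Finset.prod_pos fun i _ => (q i).pos, fun i hi => ?_⟩
  refine ⟨(∏ j ∈ T.erase i, (q j).den) * (q i).num.toNat, ?_⟩
  have hnum : (((q i).num.toNat : ℕ) : ℚ) = (q i).num := by
    exact_mod_cast Int.toNat_of_nonneg (Rat.num_nonneg.2 (hq i hi))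
  rw [← Finset.prod_erase_mul _ _ hi, Nat.cast_mul, Nat.cast_mul, hnum, mul_assoc,
    Rat.den_mul_eq_num]

/-- A positive affine monoid has a grading by `ℕ` separating any finite set of its elements. -/
theorem AffineAddMonoid.exists_addMonoidHom_nat_injOn {P : Type*} [AddCancelCommMonoid P]
    [AddMonoid.FG P] [IsAddTorsionFree P] (hpos : ∀ x y : P, x + y = 0 → x = 0) (T : Finset P) :
    ∃ φ : P →+ ℕ, Set.InjOn φ (T : Set P) := by
  obtain ⟨j, hj⟩ := AffineAddMonoid.exists_injective_finsupp_rat P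
  obtain ⟨S, hS⟩ := AddMonoid.FG.fg_top (M := P)
  obtain ⟨f, hf⟩ := exists_linearMap_pos_of_forall_nonneg_relation (S.erase 0) j (by
    intro c hc hrel i hi
    obtain ⟨k, hk, hn⟩ := exists_pos_forall_exists_natCast_eq_mul (S.erase 0) c hc
    choose! n hn using hn
    have hsum : ∑ i ∈ S.erase 0, n i • i = 0 := by
      apply hj
      rw [map_zero, map_sum, ← smul_zero (A := Fin (AffineAddMonoid.dim P) →₀ ℚ) (k : ℚ), ← hrel,
        Finset.smul_sum]
      refine Finset.sum_congr rfl fun i hi => ?_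
      rw [map_nsmul, smul_smul, ← hn i hi, Nat.cast_smul_eq_nsmul]
    rw [← Finset.add_sum_erase _ _ hi] at hsum
    have hni : n i = 0 := by
      by_contra hni
      have := hpos _ _ hsum
      exact Finset.ne_of_mem_erase hi ((smul_eq_zero_iff_right hni).1 this)
    have := hn i hi
    rw [hni, Nat.cast_zero] at this
    exact (mul_eq_zero.1 this.symm).resolve_left (by exact_mod_cast hk.ne'))
  obtain ⟨g, hg⟩ := Module.exists_dual_forall_apply_ne_zero (K := ℚ)
    (fun p : (T ×ˢ T).filter (fun p => p.1 ≠ p.2) => j p.1.1 - j p.1.2)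
    (fun p => sub_ne_zero.2 (hj.ne (Finset.mem_filter.1 p.2).2))
  obtain ⟨ε, hε, hε'⟩ := ((eventually_pos_add_mul (S.erase 0) (fun i => f (j i))
    (fun i => g (j i)) hf).and (eventually_add_mul_ne_zero ((T ×ˢ T).filter fun p => p.1 ≠ p.2)
    (fun p => f (j p.1 - j p.2)) (fun p => g (j p.1 - j p.2)) (fun p hp =>
      hg ⟨p, hp⟩))).exists
  let h : (Fin (AffineAddMonoid.dim P) →₀ ℚ) →ₗ[ℚ] ℚ := f + ε • g
  have hpos' : ∀ i ∈ S, 0 ≤ h (j i) := by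
    intro i hi
    rcases eq_or_ne i 0 with rfl | h0
    · simp
    · exact (hε i (Finset.mem_erase.2 ⟨h0, hi⟩)).le
  obtain ⟨k, hk, hn⟩ := exists_pos_forall_exists_natCast_eq_mul S _ hpos'
  have hnat : ∀ x : P, ∃ n : ℕ, (n : ℚ) = k * h (j x) := by
    intro x
    have hx : x ∈ AddSubmonoid.closure (S : Set P) := hS ▸ AddSubmonoid.mem_top x
    induction hx using AddSubmonoid.closure_induction with
    | mem x hx => exact hn x hx
    | zero => exact ⟨0, by simp⟩
    | add x y _ _ hx hy =>
      obtain ⟨m, hm⟩ := hx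
      obtain ⟨n, hn⟩ := hy
      exact ⟨m + n, by rw [Nat.cast_add, hm, hn, map_add, map_add, mul_add]⟩
  choose φ hφ using hnat
  refine ⟨⟨⟨φ, ?_⟩, ?_⟩, ?_⟩
  · have := hφ 0
    rw [map_zero, map_zero, mul_zero] at this
    exact_mod_cast this
  · intro x y
    have : (φ (x + y) : ℚ) = φ x + φ y := by
      rw [hφ, hφ, hφ, map_add, map_add, mul_add]
    exact_mod_cast this
  · intro x hx y hy hxy
    by_contra hne
    refine hε' (x, y) (Finset.mem_filter.2 ⟨Finset.mem_product.2 ⟨hx, hy⟩, hne⟩) ?_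
    change h (j x - j y) = 0
    have hk0 : (k : ℚ) ≠ 0 := by exact_mod_cast hk.ne'
    have hxy : φ x = φ y := hxy
    rw [map_sub, sub_eq_zero]
    exact mul_left_cancel₀ hk0 (by rw [← hφ, ← hφ, hxy])

/-- The ring homomorphism `B[M] → B[X]` induced by a grading of `M` by `ℕ`. -/
def MonoidAlgebra.toPolynomial (B : Type*) [CommRing B] {M : Type*} [CommMonoid M]
    (φ : Additive M →+ ℕ) : MonoidAlgebra B M →+* Polynomial B :=
  (MonoidAlgebra.lift B (Polynomial B) M
    { toFun := fun m => Polynomial.X ^ φ (Additive.ofMul m)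
      map_one' := by simp
      map_mul' := fun a b => by rw [ofMul_mul, map_add, pow_add] }).toRingHom

theorem MonoidAlgebra.coeff_toPolynomial {B : Type*} [CommRing B] {M : Type*} [CommMonoid M]
    (φ : Additive M →+ ℕ) (p : MonoidAlgebra B M) (n : ℕ) :
    (MonoidAlgebra.toPolynomial B φ p).coeff n =
      ∑ m ∈ p.coeff.support, if n = φ (Additive.ofMul m) then p.coeff m else 0 := by
  change (MonoidAlgebra.lift B (Polynomial B) M _ p).coeff n = _
  rw [MonoidAlgebra.lift_apply, Finsupp.sum, Polynomial.finsetSum_coeff]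
  refine Finset.sum_congr rfl fun m _ => ?_
  simp [Polynomial.coeff_X_pow]

theorem MonoidAlgebra.coeff_toPolynomial_mem {B : Type*} [CommRing B] {M : Type*} [CommMonoid M]
    (φ : Additive M →+ ℕ) {A : Subring B} {p : MonoidAlgebra B M} (hp : ∀ m, p.coeff m ∈ A)
    (n : ℕ) : (MonoidAlgebra.toPolynomial B φ p).coeff n ∈ A := by
  rw [MonoidAlgebra.coeff_toPolynomial]
  refine sum_mem fun m _ => ?_
  split_ifs
  exacts [hp m, zero_mem A]

theorem MonoidAlgebra.coeff_toPolynomial_of_injOn {B : Type*} [CommRing B] {M : Type*}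
    [CommMonoid M] {φ : Additive M →+ ℕ} {T : Set M}
    (hφ : Set.InjOn (fun m => φ (Additive.ofMul m)) T) {p : MonoidAlgebra B M}
    (hp : ∀ m ∈ p.coeff.support, m ∈ T) {m : M} (hm : m ∈ T) :
    (MonoidAlgebra.toPolynomial B φ p).coeff (φ (Additive.ofMul m)) = p.coeff m := by
  rw [MonoidAlgebra.coeff_toPolynomial, Finset.sum_eq_single m]
  · simp
  · exact fun n hn hne => if_neg fun h => hne (hφ (hp n hn) hm h.symm)
  · intro h
    simpa using h

theorem Subring.IsSubintegrallyClosedIn.monoidAlgebra_coeff_mem_of_fg {B ι : Type*} [CommRing B]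
    {A : Subring B} (hA : A.IsSubintegrallyClosedIn) {M : Type*} [CancelCommMonoid M]
    [Monoid.FG M] [IsMulTorsionFree M] (hpos : ∀ a b : M, a * b = 1 → a = 1) [Fintype ι]
    (x y : ι → MonoidAlgebra B M) (hxy : ∀ i j m, (x i * y j).coeff m ∈ A)
    (hone : ∑ i, x i * y i = 1) (hx : ∀ i, (x i).coeff 1 ∈ A) (hy : ∀ i, (y i).coeff 1 ∈ A)
    (i : ι) (m : M) : (x i).coeff m ∈ A := by
  let T : Finset M := insert 1 (Finset.univ.biUnion fun i =>
    (x i).coeff.support ∪ (y i).coeff.support)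
  obtain ⟨φ, hφ⟩ := AffineAddMonoid.exists_addMonoidHom_nat_injOn (P := Additive M)
    (fun a b h => hpos a.toMul b.toMul h) (T.map Additive.ofMul.toEmbedding)
  have hinj : Set.InjOn (fun m => φ (Additive.ofMul m)) (T : Set M) := fun a ha b hb h =>
    Additive.ofMul.injective (hφ (by simpa using ha) (by simpa using hb) h)
  have hxT : ∀ i, ∀ m ∈ (x i).coeff.support, m ∈ (T : Set M) := fun i m hm =>
    Finset.mem_insert_of_mem (Finset.mem_biUnion.2
      ⟨i, Finset.mem_univ i, Finset.mem_union_left _ hm⟩)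
  have hyT : ∀ i, ∀ m ∈ (y i).coeff.support, m ∈ (T : Set M) := fun i m hm =>
    Finset.mem_insert_of_mem (Finset.mem_biUnion.2
      ⟨i, Finset.mem_univ i, Finset.mem_union_right _ hm⟩)
  have h1T : (1 : M) ∈ (T : Set M) := Finset.mem_insert_self _ _
  have h0 : φ (Additive.ofMul 1) = 0 := map_zero φ
  have key := hA.coeff_mem_of_sum_mul_eq_one
    (fun i => MonoidAlgebra.toPolynomial B φ (x i)) (fun i => MonoidAlgebra.toPolynomial B φ (y i))
    (fun i j n => by
      rw [← map_mul]
      exact MonoidAlgebra.coeff_toPolynomial_mem φ (hxy i j) n)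
    (by simp only [← map_mul, ← map_sum, hone, map_one])
    (fun i => by
      rw [← h0, MonoidAlgebra.coeff_toPolynomial_of_injOn hinj (hxT i) h1T]
      exact hx i)
    (fun i => by
      rw [← h0, MonoidAlgebra.coeff_toPolynomial_of_injOn hinj (hyT i) h1T]
      exact hy i)
  by_cases hm : m ∈ (x i).coeff.support
  · have := key i (φ (Additive.ofMul m))
    rwa [MonoidAlgebra.coeff_toPolynomial_of_injOn hinj (hxT i) (hxT i m hm)] at this
  · rw [Finsupp.notMem_support_iff.1 hm]
    exact zero_mem A

theorem Subring.IsSubintegrallyClosedIn.monoidAlgebra_coeff_mem {B ι : Type*} [CommRing B]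
    {A : Subring B} (hA : A.IsSubintegrallyClosedIn) {M : Type*} [CancelCommMonoid M]
    [IsMulTorsionFree M] (hpos : ∀ a b : M, a * b = 1 → a = 1) [Fintype ι]
    (x y : ι → MonoidAlgebra B M) (hxy : ∀ i j m, (x i * y j).coeff m ∈ A)
    (hone : ∑ i, x i * y i = 1) (hx : ∀ i, (x i).coeff 1 ∈ A) (hy : ∀ i, (y i).coeff 1 ∈ A)
    (i : ι) (m : M) : (x i).coeff m ∈ A := by
  let T : Finset M := Finset.univ.biUnion fun i => (x i).coeff.support ∪ (y i).coeff.support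
  let N : Submonoid M := Submonoid.closure (T : Set M)
  have : IsMulTorsionFree N := ⟨fun n hn a b h => Subtype.ext
    (pow_left_injective hn (congrArg Subtype.val h))⟩
  let : CancelCommMonoid N :=
    { (inferInstance : CommMonoid N) with
      mul_left_cancel := fun a _ _ h => Subtype.ext
        (mul_left_cancel (a := (a : M)) (congrArg Subtype.val h)) }
  have hinj : Function.Injective N.subtype := N.subtype_injective
  let F : MonoidAlgebra B N →+* MonoidAlgebra B M := MonoidAlgebra.mapDomainRingHom B N.subtype
  have hF : ∀ p n, (F p).coeff (N.subtype n) = p.coeff n := fun p n =>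
    Finsupp.mapDomain_apply hinj p.coeff n
  have hFinj : Function.Injective F := MonoidAlgebra.mapDomain_injective hinj
  have hxN : ∀ i, F (MonoidAlgebra.comapDomain N.subtype hinj (x i)) = x i := fun i =>
    MonoidAlgebra.mapDomain_comapDomain (fun m hm => ⟨⟨m, Submonoid.subset_closure
      (Finset.mem_biUnion.2 ⟨i, Finset.mem_univ i, Finset.mem_union_left _ hm⟩)⟩, rfl⟩) hinj
  have hyN : ∀ i, F (MonoidAlgebra.comapDomain N.subtype hinj (y i)) = y i := fun i =>
    MonoidAlgebra.mapDomain_comapDomain (fun m hm => ⟨⟨m, Submonoid.subset_closure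
      (Finset.mem_biUnion.2 ⟨i, Finset.mem_univ i, Finset.mem_union_right _ hm⟩)⟩, rfl⟩) hinj
  have key := hA.monoidAlgebra_coeff_mem_of_fg (M := N)
    (fun a b h => Subtype.ext (hpos a.1 b.1 (congrArg Subtype.val h)))
    (fun i => MonoidAlgebra.comapDomain N.subtype hinj (x i))
    (fun i => MonoidAlgebra.comapDomain N.subtype hinj (y i))
    (fun i j n => by
      rw [← hF, map_mul, hxN, hyN]
      exact hxy i j _)
    (hFinj (by simp only [map_sum, map_mul, hxN, hyN, hone, map_one]))
    (fun i => by
      rw [← hF, hxN]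
      exact hx i)
    (fun i => by
      rw [← hF, hyN]
      exact hy i)
  by_cases hm : m ∈ (x i).coeff.support
  · have := key i ⟨m, Submonoid.subset_closure
      (Finset.mem_biUnion.2 ⟨i, Finset.mem_univ i, Finset.mem_union_left _ hm⟩)⟩
    rwa [← hF, hxN] at this
  · rw [Finsupp.notMem_support_iff.1 hm]
    exact zero_mem A

/-- Extension of submodules along a ring homomorphism `f : B → C` carrying the subring `A` into
the subring `D`: the `A`-submodule `I` is sent to the `D`-submodule generated by `f(I)`. -/
def Subring.submoduleSpanMap {B C : Type*} [CommRing B] [CommRing C] (f : B →+* C) (A : Subring B)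
    (D : Subring C) (h : ∀ a ∈ A, f a ∈ D) : Submodule A B →* Submodule D C where
  toFun I := Submodule.span D (f '' (I : Set B))
  map_one' := by
    rw [Submodule.one_eq_span, Submodule.one_eq_span]
    refine le_antisymm (Submodule.span_le.2 ?_) (Submodule.span_mono ?_)
    · rintro _ ⟨b, hb, rfl⟩
      obtain ⟨a, rfl⟩ := Submodule.mem_span_singleton.1 hb
      refine Submodule.mem_span_singleton.2 ⟨⟨f a, h a a.2⟩, ?_⟩
      simp [Subring.smul_def]
    · rw [Set.singleton_subset_iff]
      exact ⟨1, Submodule.mem_span_singleton_self 1, map_one f⟩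
  map_mul' I J := by
    rw [Submodule.span_mul_span]
    refine le_antisymm (Submodule.span_le.2 ?_) (Submodule.span_mono ?_)
    · rintro _ ⟨b, hb, rfl⟩
      induction hb using Submodule.mul_induction_on' with
      | mem_mul_mem x hx y hy =>
        rw [map_mul]
        exact Submodule.subset_span
          (Set.mul_mem_mul (Set.mem_image_of_mem f hx) (Set.mem_image_of_mem f hy))
      | add x _ y _ hx hy =>
        rw [map_add]
        exact Submodule.add_mem _ hx hy
    · rintro _ ⟨_, ⟨x, hx, rfl⟩, _, ⟨y, hy, rfl⟩, rfl⟩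
      exact ⟨x * y, Submodule.mul_mem_mul hx hy, map_mul f x y⟩

theorem Subring.submoduleSpanMap_apply {B C : Type*} [CommRing B] [CommRing C] (f : B →+* C)
    (A : Subring B) (D : Subring C) (h : ∀ a ∈ A, f a ∈ D) (I : Submodule A B) :
    Subring.submoduleSpanMap f A D h I = Submodule.span D (f '' (I : Set B)) :=
  rfl

theorem Subring.submoduleSpanMap_leftInverse {B C : Type*} [CommRing B] [CommRing C]
    (f : B →+* C) (g : C →+* B) (A : Subring B) (D : Subring C) (hf : ∀ a ∈ A, f a ∈ D)
    (hg : ∀ d ∈ D, g d ∈ A) (hgf : ∀ b, g (f b) = b) (I : Submodule A B) :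
    Subring.submoduleSpanMap g D A hg (Subring.submoduleSpanMap f A D hf I) = I := by
  simp only [Subring.submoduleSpanMap_apply]
  refine le_antisymm (Submodule.span_le.2 ?_) fun b hb => ?_
  · rintro _ ⟨c, hc, rfl⟩
    induction hc using Submodule.span_induction with
    | mem c hc =>
      obtain ⟨b, hb, rfl⟩ := hc
      rwa [hgf]
    | zero =>
      rw [map_zero]
      exact I.zero_mem
    | add c d _ _ hc hd =>
      rw [map_add]
      exact I.add_mem hc hd
    | smul r c _ hc =>
      rw [Subring.smul_def, smul_eq_mul, map_mul]
      exact I.smul_mem ⟨g r, hg r r.2⟩ hc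
  · exact Submodule.subset_span ⟨f b, Submodule.subset_span ⟨b, hb, rfl⟩, hgf b⟩

theorem Subring.mem_one_submodule {B : Type*} [CommRing B] {A : Subring B} {b : B} :
    b ∈ (1 : Submodule A B) ↔ b ∈ A := by
  rw [Submodule.mem_one]
  exact ⟨fun ⟨a, ha⟩ => ha ▸ a.2, fun h => ⟨⟨b, h⟩, rfl⟩⟩

theorem Submodule.exists_fin_sum_mul_of_mem_mul {R C : Type*} [CommRing R] [CommRing C]
    [Algebra R C] {P Q : Submodule R C} {z : C} (hz : z ∈ P * Q) :
    ∃ (n : ℕ) (x y : Fin n → C), (∀ i, x i ∈ P) ∧ (∀ i, y i ∈ Q) ∧ ∑ i, x i * y i = z := by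
  induction hz using Submodule.mul_induction_on' with
  | mem_mul_mem p hp q hq => exact ⟨1, fun _ => p, fun _ => q, fun _ => hp, fun _ => hq, by simp⟩
  | add a _ b _ ha hb =>
    obtain ⟨m, x, y, hx, hy, rfl⟩ := ha
    obtain ⟨n, u, v, hu, hv, rfl⟩ := hb
    refine ⟨m + n, Fin.append x u, Fin.append y v, ?_, ?_, ?_⟩
    · exact Fin.addCases (by simpa using hx) (by simpa using hu)
    · exact Fin.addCases (by simpa using hy) (by simpa using hv)
    · simp [Fin.sum_univ_add]

theorem coeff_mem_of_mem_monoidAlgebraSubring {B : Type*} [CommRing B] {M : Type*} [CommMonoid M]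
    {A : Subring B} {N : Submonoid M} {p : MonoidAlgebra B M}
    (hp : p ∈ monoidAlgebraSubring A N) (m : M) : p.coeff m ∈ A := by
  have hp : p ∈ (MonoidAlgebra.mapRingHom M A.subtype).range := by
    refine (Subring.closure_le.2 ?_ : monoidAlgebraSubring A N ≤ _) hp
    rintro _ ⟨a, ha, m, -, rfl⟩
    exact ⟨MonoidAlgebra.single m ⟨a, ha⟩, by simp⟩
  obtain ⟨q, rfl⟩ := hp
  simp

theorem mem_monoidAlgebraSubring_top {B : Type*} [CommRing B] {M : Type*} [CommMonoid M]
    {A : Subring B} {p : MonoidAlgebra B M} :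
    p ∈ monoidAlgebraSubring A (⊤ : Submonoid M) ↔ ∀ m, p.coeff m ∈ A := by
  refine ⟨coeff_mem_of_mem_monoidAlgebraSubring, fun h => ?_⟩
  rw [← MonoidAlgebra.sum_coeff_single p]
  exact sum_mem fun m _ => Subring.subset_closure ⟨_, h m, m, Submonoid.mem_top m, rfl⟩

/-- The retraction `B[M] → B` taking the constant coefficient, for a positive monoid `M`. -/
def MonoidAlgebra.constantCoeffOfPositive (B : Type*) [CommRing B] {M : Type*} [CommMonoid M]
    (hpos : ∀ a b : M, a * b = 1 → a = 1) : MonoidAlgebra B M →+* B :=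
  (MonoidAlgebra.lift B B M
    { toFun := fun m => if m = 1 then 1 else 0
      map_one' := if_pos rfl
      map_mul' := fun a b => by
        by_cases ha : a = 1
        · simp [ha]
        · rw [if_neg ha, zero_mul, if_neg fun h => ha (hpos a b h)] }).toRingHom

theorem MonoidAlgebra.constantCoeffOfPositive_apply {B : Type*} [CommRing B] {M : Type*}
    [CommMonoid M] (hpos : ∀ a b : M, a * b = 1 → a = 1) (p : MonoidAlgebra B M) :
    MonoidAlgebra.constantCoeffOfPositive B hpos p = p.coeff 1 := by
  change MonoidAlgebra.lift B B M _ p = _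
  rw [MonoidAlgebra.lift_apply, Finsupp.sum, Finset.sum_eq_single 1]
  · simp
  · exact fun m _ hm => by simp [hm]
  · intro h
    simpa using h

theorem Subring.IsSubintegrallyClosedIn.submodule_le_one_of_mul_eq_one {B : Type*} [CommRing B]
    {A : Subring B} (hA : A.IsSubintegrallyClosedIn) {M : Type*} [CancelCommMonoid M]
    [IsMulTorsionFree M] (hpos : ∀ a b : M, a * b = 1 → a = 1)
    {P Q : Submodule (monoidAlgebraSubring A (⊤ : Submonoid M)) (MonoidAlgebra B M)}
    (hPQ : P * Q = 1) (hP : ∀ p ∈ P, p.coeff 1 ∈ A) (hQ : ∀ q ∈ Q, q.coeff 1 ∈ A) : P ≤ 1 := by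
  intro w hw
  rw [Subring.mem_one_submodule, mem_monoidAlgebraSubring_top]
  obtain ⟨n, x, y, hx, hy, hxy⟩ := Submodule.exists_fin_sum_mul_of_mem_mul
    (hPQ ▸ Submodule.mem_one.2 ⟨1, map_one _⟩ : (1 : MonoidAlgebra B M) ∈ P * Q)
  have hx' : ∀ i, (Fin.cons w x : Fin (n + 1) → MonoidAlgebra B M) i ∈ P :=
    Fin.cases hw hx
  have hy' : ∀ i, (Fin.cons 0 y : Fin (n + 1) → MonoidAlgebra B M) i ∈ Q :=
    Fin.cases Q.zero_mem hy
  refine hA.monoidAlgebra_coeff_mem hpos (Fin.cons w x : Fin (n + 1) → MonoidAlgebra B M)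
    (Fin.cons 0 y) (fun i j => ?_) (by simp [Fin.sum_univ_succ, hxy]) (fun i => hP _ (hx' i))
    (fun i => hQ _ (hy' i)) 0
  exact mem_monoidAlgebraSubring_top.1 (Subring.mem_one_submodule.1
    (hPQ ▸ Submodule.mul_mem_mul (hx' i) (hy' j)))

/-- **Sarwar, Theorem 1.2(c).**  If `A ⊆ B` is an extension of commutative rings that is
subintegrally closed and `M` is a positive commutative cancellative torsion-free monoid, then
the canonical map `θ : 𝓘(A,B) → 𝓘(A[M],B[M])` is an isomorphism; no reducedness assumption on
`B` is needed.  (Here `M = N`, i.e. we take the full submonoid `⊤` of `M`.) -/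
theorem theta_isIso_of_subintegrallyClosed_self
    {B : Type*} [CommRing B] (A : Subring B)
    {M : Type*} [CancelCommMonoid M]
    (htf : MulTorsionFree M) (hpos : IsPositiveMonoid M)
    (hA : A.IsSubintegrallyClosedIn) :
    ThetaIsIso A (⊤ : Submonoid M) := by
  have : IsMulTorsionFree M := ⟨fun n hn a b h => htf a b n hn h⟩
  have hpos' : ∀ a b : M, a * b = 1 → a = 1 := fun a b h => hpos a (IsUnit.of_mul_eq_one b h)
  let σ : B →+* MonoidAlgebra B M := MonoidAlgebra.singleOneRingHom
  let ε := MonoidAlgebra.constantCoeffOfPositive B hpos'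
  let D := monoidAlgebraSubring A (⊤ : Submonoid M)
  have hσ : ∀ a ∈ A, σ a ∈ D := fun a ha =>
    Subring.subset_closure ⟨a, ha, 1, Submonoid.mem_top 1, rfl⟩
  have hε : ∀ d ∈ D, ε d ∈ A := fun d hd => by
    rw [MonoidAlgebra.constantCoeffOfPositive_apply]
    exact coeff_mem_of_mem_monoidAlgebraSubring hd 1
  have hεσ : ∀ b, ε (σ b) = b := fun b => by
    rw [MonoidAlgebra.constantCoeffOfPositive_apply]
    simp [σ]
  let Θ : (Submodule A B)ˣ →* (Submodule D (MonoidAlgebra B M))ˣ :=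
    Units.map (Subring.submoduleSpanMap σ A D hσ)
  let E : (Submodule D (MonoidAlgebra B M))ˣ →* (Submodule A B)ˣ :=
    Units.map (Subring.submoduleSpanMap ε D A hε)
  have hEΘ : ∀ I, E (Θ I) = I := fun I =>
    Units.ext (Subring.submoduleSpanMap_leftInverse σ ε A D hσ hε hεσ I)
  have hcoeff : ∀ U, E U = 1 → ∀ p ∈ (U : Submodule D (MonoidAlgebra B M)), p.coeff 1 ∈ A := by
    intro U hU p hp
    rw [← MonoidAlgebra.constantCoeffOfPositive_apply hpos', ← Subring.mem_one_submodule]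
    have hU : Subring.submoduleSpanMap ε D A hε U = 1 := congrArg Units.val hU
    rw [← hU]
    exact Submodule.subset_span ⟨p, hp, rfl⟩
  have hle : ∀ U, E U = 1 → (U : Submodule D (MonoidAlgebra B M)) ≤ 1 := fun U hU =>
    hA.submodule_le_one_of_mul_eq_one hpos' U.mul_inv (hcoeff U hU)
      (hcoeff U⁻¹ (by rw [map_inv, hU, inv_one]))
  have hker : ∀ U, E U = 1 → U = 1 := by
    refine fun U hU => Units.ext (le_antisymm (hle U hU) ?_)
    calc (1 : Submodule D (MonoidAlgebra B M)) = U * ↑U⁻¹ := U.mul_inv.symm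
      _ ≤ U * 1 := mul_le_mul_right (hle U⁻¹ (by rw [map_inv, hU, inv_one])) _
      _ = U := mul_one _
  refine ⟨MulEquiv.ofBijective Θ ⟨Function.LeftInverse.injective hEΘ, fun U => ⟨E U, ?_⟩⟩,
    fun I => rfl⟩
  have := hker (U * (Θ (E U))⁻¹) (by rw [map_mul, map_inv, hEΘ, mul_inv_cancel])
  exact (mul_inv_eq_one.1 this).symm
end
end

section
/- Let A ⊆ B be an extension of commutative rings and M ⊆ N an extension of positive commutative cancellative torsion-free monoids such that A is subintegrally closed in B and M is subintegrally closed in N. If B is reduced or M = N, then A[M] is subintegrally closed in B[N]. -/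
open scoped Classical

noncomputable section

open Polynomial

/-- The elements that some power of `c` multiplies into the subring `R`. -/
def Subring.powSaturation {S : Type*} [CommRing S] (R : Subring S) (c : R) : Subalgebra R S where
  carrier := {y | ∃ e : ℕ, (c : S) ^ e * y ∈ R}
  mul_mem' := by
    rintro a b ⟨e, he⟩ ⟨e', he'⟩
    refine ⟨e + e', ?_⟩
    convert R.mul_mem he he' using 1
    ring
  add_mem' := by
    rintro a b ⟨e, he⟩ ⟨e', he'⟩
    refine ⟨e + e', ?_⟩
    convert R.add_mem (R.mul_mem (pow_mem c.2 e') he) (R.mul_mem (pow_mem c.2 e) he') using 1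
    ring
  algebraMap_mem' r := ⟨0, by rw [pow_zero, one_mul]; exact r.2⟩

namespace Subring

variable {S : Type*} [CommRing S] {R : Subring S}

theorem mem_powSaturation {c : R} {y : S} :
    y ∈ R.powSaturation c ↔ ∃ e : ℕ, (c : S) ^ e * y ∈ R := Iff.rfl

theorem mem_of_mul_mem_powSaturation {c : R} {y : S} (e : ℕ)
    (h : (c : S) ^ e * y ∈ R.powSaturation c) : y ∈ R.powSaturation c := by
  obtain ⟨e', he'⟩ := h
  exact ⟨e' + e, by rwa [pow_add, mul_assoc]⟩

theorem exists_pow_mul_mem_of_fg {c : R} {T : Subalgebra R S}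
    (hT : (Subalgebra.toSubmodule T).FG) (hle : T ≤ R.powSaturation c) :
    ∃ e : ℕ, ∀ y ∈ T, (c : S) ^ e * y ∈ R := by
  obtain ⟨s, hs⟩ := hT
  have hsT : ∀ y ∈ s, ∃ e : ℕ, (c : S) ^ e * y ∈ R := fun y hy ↦
    hle (show y ∈ Subalgebra.toSubmodule T from hs ▸ Submodule.subset_span hy)
  choose! e he using hsT
  refine ⟨s.sup e, fun y hy ↦ ?_⟩
  replace hy : y ∈ Submodule.span R (s : Set S) := by rw [hs]; exact hy
  induction hy using Submodule.span_induction with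
  | mem x hx =>
    have := R.mul_mem (pow_mem c.2 (s.sup e - e x)) (he x hx)
    rwa [← mul_assoc, ← pow_add, Nat.sub_add_cancel (Finset.le_sup hx)] at this
  | zero => simp
  | add x y _ _ hx hy => rw [mul_add]; exact R.add_mem hx hy
  | smul a x _ hx =>
    rw [Subring.smul_def, smul_eq_mul, mul_left_comm]
    exact R.mul_mem a.2 hx

variable {H : Submonoid S}

theorem mem_of_forall_pow_mem (hH : ∀ x ∈ H, x ^ 2 ∈ R → x ^ 3 ∈ R → x ∈ R) {x : S} (hx : x ∈ H)
    (e : ℕ) (h : ∀ k > e, x ^ k ∈ R) : x ∈ R := by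
  induction e with
  | zero => simpa using h 1 one_pos
  | succ e ih =>
    refine ih fun k hk ↦ ?_
    rcases eq_or_lt_of_le (Nat.succ_le_of_lt hk) with rfl | hk
    · refine hH _ (pow_mem hx _) ?_ ?_ <;> rw [← pow_mul] <;> exact h _ (by lia)
    · exact h _ hk

theorem mul_mem_of_mem_adjoin (hH : ∀ x ∈ H, x ^ 2 ∈ R → x ^ 3 ∈ R → x ∈ R) {s : Set S}
    (hs : s ⊆ H) {c : S} (hc : c ∈ H) {e : ℕ} (he : ∀ y ∈ Algebra.adjoin R s, c ^ e * y ∈ R)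
    (hcs : c ∈ Algebra.adjoin R s) {y : S} (hy : y ∈ Algebra.adjoin R s) : c * y ∈ R := by
  replace hy : y ∈ Submodule.span R (Submonoid.closure s : Set S) := by
    rw [← Algebra.adjoin_eq_span]; exact hy
  induction hy using Submodule.span_induction with
  | mem x hx =>
    have hxs : x ∈ Algebra.adjoin R s := by
      rw [← Subalgebra.mem_toSubmodule, Algebra.adjoin_eq_span]
      exact Submodule.subset_span hx
    refine mem_of_forall_pow_mem hH (mul_mem hc (Submonoid.closure_le.2 hs hx)) e fun k hk ↦ ?_
    have := he _ (mul_mem (pow_mem hcs (k - e)) (pow_mem hxs k))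
    rwa [← mul_assoc, ← pow_add, Nat.add_sub_cancel' hk.le, ← mul_pow] at this
  | zero => simp
  | add x y _ _ hx hy => rw [mul_add]; exact R.add_mem hx hy
  | smul a x _ hx =>
    rw [Subring.smul_def, smul_eq_mul, mul_left_comm]
    exact R.mul_mem a.2 hx

theorem isIntegral_coeff_of_pow {p : S[X]} {n : ℕ} (hn : 0 < n)
    (hp : ∀ i, (p ^ n).coeff i ∈ R) (i : ℕ) : IsIntegral R (p.coeff i) := by
  let : Algebra R[X] S[X] := Polynomial.algebra _ _
  refine IsIntegral.coeff (IsIntegral.of_pow hn ?_) i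
  have : p ^ n ∈ (mapRingHom R.subtype).range := by
    rw [Polynomial.mem_map_range]; simpa using hp
  obtain ⟨q, hq⟩ := this
  rw [← hq]
  exact isIntegral_algebraMap (R := R[X]) (x := q)

theorem coeff_mem_powSaturation {q : S[X]} (h0 : q.coeff 0 ∈ R)
    (h2 : ∀ i, (q ^ 2).coeff i ∈ R) (h3 : ∀ i, (q ^ 3).coeff i ∈ R) (i : ℕ) :
    q.coeff i ∈ R.powSaturation ⟨q.coeff 0, h0⟩ := by
  have hle : ∀ {x}, x ∈ R → x ∈ R.powSaturation ⟨q.coeff 0, h0⟩ := fun hx ↦ ⟨0, by simpa using hx⟩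
  induction i using Nat.strong_induction_on with
  | _ i ih =>
    refine mem_of_mul_mem_powSaturation 2 ?_
    have h := hle (h3 i)
    rw [pow_succ, coeff_mul, Finset.Nat.sum_antidiagonal_eq_sum_range_succ_mk,
      Finset.sum_range_succ'] at h
    simp only [Nat.sub_zero] at h
    rw [show (q ^ 2).coeff 0 = q.coeff 0 ^ 2 by simp [coeff_zero_eq_eval_zero]] at h
    refine (add_mem_cancel_left (sum_mem fun j hj ↦ mul_mem (hle (h2 _)) (ih _ ?_))).1 h
    have := Finset.mem_range.1 hj
    lia

theorem polynomial_coeff_mem (hH : ∀ x ∈ H, x ^ 2 ∈ R → x ^ 3 ∈ R → x ∈ R) {p : S[X]}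
    (hp : ∀ i, p.coeff i ∈ H) (h2 : ∀ i, (p ^ 2).coeff i ∈ R) (h3 : ∀ i, (p ^ 3).coeff i ∈ R)
    (k : ℕ) : p.coeff k ∈ R := by
  set s : Set S := Set.range p.coeff
  have hsH : s ⊆ H := by rintro _ ⟨i, rfl⟩; exact hp i
  set T := Algebra.adjoin R s
  have hpT (i : ℕ) : p.coeff i ∈ T := Algebra.subset_adjoin ⟨i, rfl⟩
  have hfin : s.Finite := by
    refine (p.coeffs.finite_toSet.insert 0).subset ?_
    rintro _ ⟨i, rfl⟩
    by_cases h : p.coeff i = 0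
    · simp [h]
    · exact Or.inr (coeff_mem_coeffs h)
  have hT : (Subalgebra.toSubmodule T).FG := fg_adjoin_of_finite hfin (by
    rintro _ ⟨i, rfl⟩; exact isIntegral_coeff_of_pow two_pos h2 i)
  suffices h : ∀ y ∈ T, p.coeff k * y ∈ R by simpa using h 1 (one_mem _)
  induction k using Nat.strong_induction_on with
  | _ k ih =>
    set q : S[X] := divX^[k] p with hq
    have hqc (i : ℕ) : q.coeff i = p.coeff (i + k) := by
      rw [hq]
      clear_value q
      clear hq ih
      induction k generalizing i with
      | zero => rfl
      | succ k ihk => rw [Function.iterate_succ_apply', coeff_divX, ihk]; congr 1; lia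
    set l : S[X] := p - X ^ k * q with hl
    have hlc (i : ℕ) : l.coeff i = if i < k then p.coeff i else 0 := by
      rw [hl, coeff_sub, coeff_X_pow_mul']
      split_ifs with h h' h'
      · lia
      · rw [hqc, Nat.sub_add_cancel h, sub_self]
      · simp
      · lia
    have hmul {t : S[X]} (ht : ∀ i, t.coeff i ∈ T) (i : ℕ) : (l * t).coeff i ∈ R := by
      rw [coeff_mul]
      refine sum_mem fun x _ ↦ ?_
      rw [hlc]
      split_ifs with h
      · exact ih _ h _ (ht _)
      · simp
    have hTiff (t : S[X]) : t ∈ (mapRingHom T.toSubring.subtype).range ↔ ∀ i, t.coeff i ∈ T := by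
      rw [Polynomial.mem_map_range, Subring.range_subtype]
      rfl
    have hpT' := (hTiff p).2 hpT
    have hqT' : X ^ k * q ∈ (mapRingHom T.toSubring.subtype).range := by
      rw [hTiff]
      intro i
      rw [coeff_X_pow_mul', hqc]
      split_ifs
      exacts [hpT _, zero_mem _]
    have h2q (i : ℕ) : (q ^ 2).coeff i ∈ R := by
      have := sub_mem (h2 (i + k * 2))
        (hmul ((hTiff (p + X ^ k * q)).1 (add_mem hpT' hqT')) (i + k * 2))
      rw [← coeff_sub, show p ^ 2 - l * (p + X ^ k * q) = X ^ (k * 2) * q ^ 2 by rw [hl]; ring,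
        coeff_X_pow_mul] at this
      exact this
    have h3q (i : ℕ) : (q ^ 3).coeff i ∈ R := by
      have := sub_mem (h3 (i + k * 3))
        (hmul ((hTiff (p ^ 2 + p * (X ^ k * q) + (X ^ k * q) ^ 2)).1
          (add_mem (add_mem (pow_mem hpT' 2) (mul_mem hpT' hqT')) (pow_mem hqT' 2))) (i + k * 3))
      rw [← coeff_sub, show p ^ 3 - l * (p ^ 2 + p * (X ^ k * q) + (X ^ k * q) ^ 2)
        = X ^ (k * 3) * q ^ 3 by rw [hl]; ring, coeff_X_pow_mul] at this
      exact this
    have hq0 : q.coeff 0 = p.coeff k := by rw [hqc, zero_add]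
    have h0 : q.coeff 0 ∈ R := by
      refine hH _ (hq0 ▸ hp k) ?_ ?_
      · simpa [coeff_zero_eq_eval_zero] using h2q 0
      · simpa [coeff_zero_eq_eval_zero] using h3q 0
    have hle : T ≤ R.powSaturation ⟨q.coeff 0, h0⟩ := by
      refine Algebra.adjoin_le ?_
      rintro _ ⟨i, rfl⟩
      rcases lt_or_ge i k with h | h
      · exact ⟨0, by simpa using ih i h 1 (one_mem _)⟩
      · obtain ⟨j, rfl⟩ := Nat.exists_eq_add_of_le' h
        exact hqc j ▸ coeff_mem_powSaturation h0 h2q h3q j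
    obtain ⟨e, he⟩ := exists_pow_mul_mem_of_fg hT hle
    exact fun y hy ↦ mul_mem_of_mem_adjoin hH hsH (hp k) (e := e) (by simpa [hq0] using he)
      (hpT k) hy

end Subring

/-- A finite subset of a cancellative torsion-free commutative monoid is separated by some
homomorphism to `ℚ`. -/
theorem exists_monoidHom_rat_injOn {N : Type*} [CancelCommMonoid N] [IsMulTorsionFree N]
    (s : Finset N) : ∃ φ : N →* Multiplicative ℚ, Set.InjOn φ s := by
  let G := Additive (Algebra.GrothendieckGroup N)
  let ι : N → DivisibleHull G := fun n ↦ ((Additive.ofMul (Algebra.GrothendieckGroup.of n) : G) :)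
  have hι : Function.Injective ι := fun a b h ↦
    Algebra.GrothendieckGroup.of_injective (Additive.ofMul.injective (DivisibleHull.coe_injective h))
  obtain ⟨f, hf⟩ := Module.exists_dual_forall_apply_ne_zero (K := ℚ)
    (fun p : {p : s × s // p.1 ≠ p.2} ↦ ι p.1.1 - ι p.1.2)
    (fun p h ↦ p.2 (Subtype.ext (hι (sub_eq_zero.1 h))))
  refine ⟨{ toFun := fun n ↦ Multiplicative.ofAdd (f (ι n)), map_one' := ?_, map_mul' := ?_ }, ?_⟩
  · have : ι 1 = 0 := by simp only [ι, map_one]; exact DivisibleHull.mk_zero 1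
    simp [this]
  · intro a b
    have : ι (a * b) = ι a + ι b := by
      simp only [ι, map_mul, ofMul_mul]; exact DivisibleHull.coe_add
    simp [this]
  · intro a ha b hb hab
    by_contra hne
    refine hf ⟨⟨⟨a, ha⟩, ⟨b, hb⟩⟩, fun h ↦ hne (congrArg Subtype.val h)⟩ ?_
    rw [map_sub, sub_eq_zero]
    exact Multiplicative.ofAdd.injective hab

/-- After scaling and translation, a separating homomorphism to `ℚ` takes natural values. -/
theorem exists_monoidHom_rat_natCast {N : Type*} [CancelCommMonoid N] [IsMulTorsionFree N]
    (s : Finset N) : ∃ (φ : N →* Multiplicative ℚ) (u : N → ℕ) (K : ℕ), Set.InjOn u s ∧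
      ∀ n ∈ s, (u n : ℚ) = K + (φ n).toAdd := by
  obtain ⟨φ, hφ⟩ := exists_monoidHom_rat_injOn s
  let D : ℕ := ∏ n ∈ s, (φ n).toAdd.den
  have hD : D ≠ 0 := Finset.prod_ne_zero_iff.2 fun n _ ↦ Rat.den_nz _
  have hz : ∀ n ∈ s, ∃ z : ℤ, (z : ℚ) = D * (φ n).toAdd := by
    intro n hn
    obtain ⟨d, hd⟩ : (φ n).toAdd.den ∣ D := Finset.dvd_prod_of_mem _ hn
    refine ⟨d * (φ n).toAdd.num, ?_⟩
    rw [hd]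
    push_cast
    rw [mul_comm ((φ n).toAdd.den : ℚ), mul_assoc, Rat.den_mul_eq_num]
  choose! z hz using hz
  let K : ℕ := ∑ n ∈ s, (z n).natAbs
  have hK : ∀ n ∈ s, 0 ≤ K + z n := by
    intro n hn
    have : (z n).natAbs ≤ K := Finset.single_le_sum (f := fun n ↦ (z n).natAbs)
      (fun _ _ ↦ Nat.zero_le _) hn
    lia
  have hu : ∀ n ∈ s, (((K + z n).toNat : ℕ) : ℚ) = K + D * (φ n).toAdd := by
    intro n hn
    rw [← hz n hn]
    exact_mod_cast Int.toNat_of_nonneg (hK n hn)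
  refine ⟨(powMonoidHom D).comp φ, fun n ↦ (K + z n).toNat, K, ?_, ?_⟩
  · intro a ha b hb hab
    refine hφ ha hb ?_
    have h := (hu a ha).symm.trans ((congrArg Nat.cast hab).trans (hu b hb))
    exact Multiplicative.toAdd.injective
      (mul_left_cancel₀ (Nat.cast_ne_zero.2 hD) (add_left_cancel h))
  · intro n hn
    simpa using hu n hn

namespace MonoidAlgebra

variable {B : Type*} [CommRing B] {N : Type*} [CommMonoid N]

theorem coeff_mem_of_mem_monoidAlgebraSubring {A : Subring B} {M : Submonoid N}
    {x : MonoidAlgebra B N} (hx : x ∈ monoidAlgebraSubring A M) (n : N) :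
    x.coeff n ∈ A ∧ (x.coeff n ≠ 0 → n ∈ M) := by
  have hle : monoidAlgebraSubring A M ≤
      ((mapDomainRingHom B M.subtype).comp (mapRingHom M A.subtype)).range := by
    refine Subring.closure_le.2 ?_
    rintro _ ⟨a, ha, m, hm, rfl⟩
    exact ⟨single ⟨m, hm⟩ ⟨a, ha⟩, by simp⟩
  obtain ⟨y, rfl⟩ := hle hx
  have hy : (((mapDomainRingHom B M.subtype).comp (mapRingHom M A.subtype)) y).coeff =
      Finsupp.mapDomain M.subtype (mapRingHom M A.subtype y).coeff := rfl
  rw [hy]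
  by_cases hn : n ∈ M
  · refine ⟨?_, fun _ ↦ hn⟩
    rw [show n = M.subtype ⟨n, hn⟩ from rfl, Finsupp.mapDomain_apply M.subtype_injective]
    simp
  · rw [Finsupp.mapDomain_of_notMem_range _ _ (by simpa using hn)]
    simp

theorem single_mem_monoidAlgebraSubring {A : Subring B} {M : Submonoid N} {b : B} {n : N}
    (hb : b ∈ A) (hn : n ∈ M) : single n b ∈ monoidAlgebraSubring A M :=
  Subring.subset_closure ⟨b, hb, n, hn, rfl⟩

theorem single_mem_monoidAlgebraSubring_of_sq_of_cube {A : Subring B} {M : Submonoid N}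
    (hA : A.IsSubintegrallyClosedIn) (hM : M.IsSubintegrallyClosedIn)
    (h : IsReduced B ∨ M = ⊤) {b : B} {n : N}
    (h2 : single n b ^ 2 ∈ monoidAlgebraSubring A M)
    (h3 : single n b ^ 3 ∈ monoidAlgebraSubring A M) :
    single n b ∈ monoidAlgebraSubring A M := by
  rw [single_pow] at h2 h3
  replace h2 := coeff_mem_of_mem_monoidAlgebraSubring h2 (n ^ 2)
  replace h3 := coeff_mem_of_mem_monoidAlgebraSubring h3 (n ^ 3)
  simp only [coeff_single, Finsupp.single_eq_same] at h2 h3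
  rcases eq_or_ne b 0 with rfl | hb
  · simp
  refine single_mem_monoidAlgebraSubring (hA b h2.1 h3.1) ?_
  rcases h with _ | rfl
  · exact hM n (h2.2 (pow_ne_zero 2 hb)) (h3.2 (pow_ne_zero 3 hb))
  · trivial

/-- The submonoid of monomials of a monoid algebra. -/
def monomials (B N : Type*) [CommRing B] [CommMonoid N] : Submonoid (MonoidAlgebra B N) where
  carrier := {x | ∃ n b, x = single n b}
  one_mem' := ⟨1, 1, rfl⟩
  mul_mem' := by
    rintro _ _ ⟨n, b, rfl⟩ ⟨n', b', rfl⟩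
    exact ⟨n * n', b * b', single_mul_single ..⟩

/-- The regrading `b n ↦ (b n) T^(φ n)` of a monoid algebra along a homomorphism to `ℚ`. -/
def regrade (B : Type*) [CommRing B] (φ : N →* Multiplicative ℚ) :
    MonoidAlgebra B N →+* AddMonoidAlgebra (MonoidAlgebra B N) ℚ :=
  liftNCRingHom (AddMonoidAlgebra.singleZeroRingHom.comp singleOneRingHom)
    { toFun := fun n ↦ AddMonoidAlgebra.single (φ n).toAdd (single n 1)
      map_one' := by simp; rfl
      map_mul' := by simp [AddMonoidAlgebra.single_mul_single, single_mul_single] }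
    (fun _ _ ↦ Commute.all _ _)

theorem regrade_single (φ : N →* Multiplicative ℚ) (n : N) (b : B) :
    regrade B φ (single n b) = AddMonoidAlgebra.single (φ n).toAdd (single n b) := by
  simp [regrade, AddMonoidAlgebra.single_mul_single, single_mul_single]

theorem coeff_regrade_mem {A : Subring B} {M : Submonoid N} (φ : N →* Multiplicative ℚ)
    {x : MonoidAlgebra B N} (hx : x ∈ monoidAlgebraSubring A M) (q : ℚ) :
    (regrade B φ x).coeff q ∈ monoidAlgebraSubring A M := by
  have hle : monoidAlgebraSubring A M ≤
      ((AddMonoidAlgebra.mapRingHom ℚ (monoidAlgebraSubring A M).subtype).range).comap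
        (regrade B φ) := by
    refine Subring.closure_le.2 ?_
    rintro _ ⟨a, ha, m, hm, rfl⟩
    exact ⟨AddMonoidAlgebra.single (φ m).toAdd ⟨_, single_mem_monoidAlgebraSubring ha hm⟩,
      by simp [regrade_single]⟩
  obtain ⟨y, hy⟩ := hle hx
  rw [← hy]
  simp

end MonoidAlgebra

namespace Polynomial

/-- Polynomials as elements of the monoid algebra with rational exponents. -/
def toRatExponents (S : Type*) [CommRing S] : S[X] →+* AddMonoidAlgebra S ℚ :=
  (AddMonoidAlgebra.mapDomainRingHom S (Nat.castAddMonoidHom ℚ)).comp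
    (toFinsuppIso S).toRingHom

variable {S : Type*} [CommRing S]

theorem toRatExponents_monomial (n : ℕ) (a : S) :
    toRatExponents S (monomial n a) = AddMonoidAlgebra.single (n : ℚ) a := by
  simp [toRatExponents]

theorem coeff_toRatExponents (p : S[X]) (n : ℕ) :
    (toRatExponents S p).coeff (n : ℚ) = p.coeff n :=
  Finsupp.mapDomain_apply Nat.cast_injective p.toFinsupp.coeff n

theorem coeff_mem_of_toRatExponents_eq {R : Subring S} {p : S[X]} {K : ℚ}
    {F : AddMonoidAlgebra S ℚ} (hF : ∀ q, F.coeff q ∈ R)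
    (h : toRatExponents S p = AddMonoidAlgebra.single K 1 * F) (i : ℕ) : p.coeff i ∈ R := by
  rw [← coeff_toRatExponents, h, AddMonoidAlgebra.coeff_single_mul_apply, one_mul]
  exact hF _

end Polynomial

open MonoidAlgebra in
/-- **Sarwar, Corollary 1.3(i).**  If `A ⊆ B` is subintegrally closed, `M ⊆ N` is a
subintegrally closed extension of positive commutative cancellative torsion-free monoids, and
moreover `B` is reduced or `M = N`, then `A[M]` is subintegrally closed in `B[N]`. -/
theorem monoidAlgebra_subintegrallyClosed_of_isReduced_or_eq_top
    {B : Type*} [CommRing B] (A : Subring B)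
    {N : Type*} [CancelCommMonoid N] (M : Submonoid N)
    (htf : MulTorsionFree N) (hpos : IsPositiveMonoid N)
    (hA : A.IsSubintegrallyClosedIn) (hM : M.IsSubintegrallyClosedIn)
    (h : IsReduced B ∨ M = ⊤) :
    (monoidAlgebraSubring A M).IsSubintegrallyClosedIn := by
  intro f hf2 hf3
  have : IsMulTorsionFree N := ⟨fun n hn x y hxy ↦ htf x y n hn hxy⟩
  set s := f.coeff.support
  have hfs : f = ∑ n ∈ s, single n (f.coeff n) := (sum_coeff_single f).symm
  obtain ⟨φ, u, K, hu, hφ⟩ := exists_monoidHom_rat_natCast s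
  let p : (MonoidAlgebra B N)[X] := ∑ n ∈ s, monomial (u n) (single n (f.coeff n))
  have hp : toRatExponents _ p = AddMonoidAlgebra.single (K : ℚ) 1 * regrade B φ f := by
    conv_rhs => rw [hfs]
    simp only [p, map_sum, Finset.mul_sum]
    refine Finset.sum_congr rfl fun n hn ↦ ?_
    rw [toRatExponents_monomial, regrade_single, AddMonoidAlgebra.single_mul_single, one_mul,
      hφ n hn]
  have hpow {k : ℕ} (hk : f ^ k ∈ monoidAlgebraSubring A M) :
      ∀ i, (p ^ k).coeff i ∈ monoidAlgebraSubring A M := by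
    refine coeff_mem_of_toRatExponents_eq (K := k • (K : ℚ)) (coeff_regrade_mem φ hk) ?_
    rw [map_pow, hp, mul_pow, AddMonoidAlgebra.single_pow, one_pow, map_pow]
  have hpu : ∀ n ∈ s, p.coeff (u n) = single n (f.coeff n) := by
    intro n hn
    simp only [p, finsetSum_coeff, coeff_monomial]
    rw [Finset.sum_eq_single_of_mem n hn fun m hm hmn ↦ if_neg fun e ↦ hmn (hu hm hn e), if_pos rfl]
  have hpm (i : ℕ) : p.coeff i ∈ monomials B N := by
    by_cases hi : ∃ n ∈ s, u n = i
    · obtain ⟨n, hn, rfl⟩ := hi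
      exact ⟨n, _, hpu n hn⟩
    · push Not at hi
      refine ⟨1, 0, ?_⟩
      simp only [p, finsetSum_coeff, coeff_monomial, single_zero]
      exact Finset.sum_eq_zero fun n hn ↦ if_neg (hi n hn)
  have key := Subring.polynomial_coeff_mem (R := monoidAlgebraSubring A M) (H := monomials B N)
    (by
      rintro _ ⟨n, b, rfl⟩
      exact single_mem_monoidAlgebraSubring_of_sq_of_cube hA hM h) hpm (hpow hf2) (hpow hf3)
  rw [hfs]
  exact sum_mem fun n hn ↦ hpu n hn ▸ key (u n)
end
end
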